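/- arXiv:1311.2337 — 2 statements merged into one kernel-verified Lean document; each statement's English description precedes it below -/
import Mathlib

section
/- Let k ≥ 1, let 𝒫 be a nonempty subset of {1,…,k}, and fix P_j > 0 and s_j > 0 for each j ∈ 𝒫. For n ≥ 3 let (U_j)_{j∈𝒫} be independent random variables, where U_j takes values in [−1,1] with density proportional to (1−u²)^{(n−3)/2}·exp(n·√(P_j s_j)·u). Then there exists N ∈ ℕ (depending only on the P_j, s_j) such that for all n ≥ N, all a ∈ ℝ and all μ > 0, Pr( Σ_{j∈𝒫} √(P_j s_j)·U_j ∈ [a/n, (a+μ)/n] ) ≤ min_{l∈𝒫} 2·L(P_l, s_l)·μ / √(n·P_l·s_l). -/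
open MeasureTheory Real
open scoped ENNReal

noncomputable section

/-- The constant `L(P,s)` from the paper. -/
def L (P s : ℝ) : ℝ :=
  (2 * P * s) ^ 2 / Real.sqrt (2 * π) *
    Real.sqrt ((1 + 4 * P * s - Real.sqrt (1 + 4 * P * s)) /
      (Real.sqrt (1 + 4 * P * s) - 1) ^ 5)

/-- Unnormalized density `(1-u²)^{(n-3)/2} exp(n √(Ps) u)` on `[-1,1]`. -/
def g (P s : ℝ) (n : ℕ) (u : ℝ) : ℝ :=
  (1 - u ^ 2) ^ (((n : ℝ) - 3) / 2) * Real.exp (n * Real.sqrt (P * s) * u)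

/-- The joint law of the independent random variables `(U_j)_{j ∈ Pc}`, where `U_j` has
density proportional to `(1-u²)^{(n-3)/2} exp(n √(P_j s_j) u)` on `[-1,1]`:
the product density with respect to Lebesgue measure on the box `[-1,1]^Pc`, normalized. -/
def jointLaw {k : ℕ} (Pc : Finset (Fin k)) (P s : Fin k → ℝ) (n : ℕ) :
    Measure ({j // j ∈ Pc} → ℝ) :=
  (ENNReal.ofReal (∏ j : {j // j ∈ Pc},
      ∫ u in Set.Icc (-1 : ℝ) 1, g (P j) (s j) n u))⁻¹ •
    ((volume.restrict (Set.univ.pi fun _ : {j // j ∈ Pc} => Set.Icc (-1 : ℝ) 1)).withDensity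
      fun u => ENNReal.ofReal (∏ j : {j // j ∈ Pc}, g (P j) (s j) n (u j)))

/-- The base of the tilted sphere density is maximal at its stationary point `v`. -/
lemma tilted_base_le {v u : ℝ} (hv : v ^ 2 < 1) :
    (1 - u ^ 2) * exp (2 * v / (1 - v ^ 2) * u) ≤
      (1 - v ^ 2) * exp (2 * v / (1 - v ^ 2) * v) := by
  have hA : 0 < 1 - v ^ 2 := by linarith
  set q := 2 * v / (1 - v ^ 2) with hq
  have hqA : q * (1 - v ^ 2) = 2 * v := by rw [hq]; field_simp
  have hexp : exp (q * u) * exp (-(q * (u - v))) = exp (q * v) := by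
    rw [← exp_add]; ring_nf
  have h1 : 1 - u ^ 2 ≤ (1 - v ^ 2) * exp (-(q * (u - v))) := by
    have h := mul_le_mul_of_nonneg_left (add_one_le_exp (-(q * (u - v)))) hA.le
    have h' : (1 - v ^ 2) * (-(q * (u - v)) + 1) = 1 - v ^ 2 - 2 * v * (u - v) := by
      linear_combination -(u - v) * hqA
    nlinarith [sq_nonneg (u - v)]
  calc (1 - u ^ 2) * exp (q * u)
      ≤ (1 - v ^ 2) * exp (-(q * (u - v))) * exp (q * u) := by gcongr
    _ = (1 - v ^ 2) * exp (q * v) := by rw [← hexp]; ring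

/-- Quadratic lower bound for the base of the tilted sphere density near its maximum. -/
lemma le_tilted_base {v t : ℝ} (hv : v ^ 2 < 1)
    (ht : 2 * (1 + v ^ 2) / (1 - v ^ 2) ^ 2 * t ^ 2 ≤ 1 / 4) :
    (1 - v ^ 2) * exp (2 * v / (1 - v ^ 2) * v) *
        (1 - 2 * (1 + v ^ 2) / (1 - v ^ 2) ^ 2 * t ^ 2) ≤
      (1 - (v + t) ^ 2) * exp (2 * v / (1 - v ^ 2) * (v + t)) := by
  have hA : 0 < 1 - v ^ 2 := by linarith
  set A := 1 - v ^ 2 with hAdef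
  obtain ⟨x, hx⟩ : ∃ x, x = 2 * v / A * t := ⟨_, rfl⟩
  obtain ⟨y, hy⟩ : ∃ y, y = t ^ 2 / A := ⟨_, rfl⟩
  have hy0 : 0 ≤ y := by rw [hy]; positivity
  have hκ : 2 * (1 + v ^ 2) / A ^ 2 * t ^ 2 = x ^ 2 + 2 * y := by
    rw [hx, hy]; field_simp; rw [hAdef]; ring
  have hbase : 1 - (v + t) ^ 2 = A * (1 - x - y) := by
    rw [hx, hy]; field_simp; rw [hAdef]; ring
  have hexp : exp (2 * v / A * (v + t)) = exp (2 * v / A * v) * exp x := by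
    rw [← exp_add, hx]; ring_nf
  rw [hκ] at ht
  have hx1 : |x| ≤ 1 / 2 := abs_le_of_sq_le_sq (by nlinarith) (by norm_num)
  obtain ⟨hxl, hxu⟩ := abs_le.mp hx1
  have key : 1 - (x ^ 2 + 2 * y) ≤ (1 - x - y) * exp x := by
    have h := mul_le_mul_of_nonneg_left (add_one_le_exp x) (show 0 ≤ 1 - x - y by nlinarith)
    nlinarith
  rw [hκ, hbase, hexp]
  calc A * exp (2 * v / A * v) * (1 - (x ^ 2 + 2 * y))
      ≤ A * exp (2 * v / A * v) * ((1 - x - y) * exp x) := by gcongr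
    _ = _ := by ring

/-- Every value of the tilted density `(1-u²)^p exp(2pvu/(1-v²))` is controlled by its integral. -/
lemma tilted_le_integral {p v u : ℝ} (hp : 4 ≤ p) (hv : v ^ 2 < 1) (hu : u ∈ Set.Icc (-1 : ℝ) 1) :
    (1 - u ^ 2) ^ p * exp (p * (2 * v / (1 - v ^ 2) * u)) ≤
      3 / 4 * √(p * (2 * (1 + v ^ 2) / (1 - v ^ 2) ^ 2)) *
        ∫ u in Set.Icc (-1 : ℝ) 1, (1 - u ^ 2) ^ p * exp (p * (2 * v / (1 - v ^ 2) * u)) := by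
  have hA : 0 < 1 - v ^ 2 := by linarith
  set κ := 2 * (1 + v ^ 2) / (1 - v ^ 2) ^ 2 with hκ
  set q := 2 * v / (1 - v ^ 2) with hq
  have hκ0 : 0 < κ := by positivity
  have hp0 : 0 < p := by linarith
  have hsq : ∀ w ∈ Set.Icc (-1 : ℝ) 1, 0 ≤ 1 - w ^ 2 := fun w hw => by nlinarith [hw.1, hw.2]
  have hform : ∀ w, 0 ≤ 1 - w ^ 2 →
      (1 - w ^ 2) ^ p * exp (p * (q * w)) = ((1 - w ^ 2) * exp (q * w)) ^ p := fun w hw => by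
    rw [mul_rpow hw (exp_pos _).le, ← exp_mul, mul_comm p]
  set M := ((1 - v ^ 2) * exp (q * v)) ^ p with hM
  have hM0 : 0 < M := by positivity
  have hupper : (1 - u ^ 2) ^ p * exp (p * (q * u)) ≤ M := by
    rw [hform u (hsq u hu)]
    exact rpow_le_rpow (mul_nonneg (hsq u hu) (exp_pos _).le) (tilted_base_le hv) hp0.le
  set σ := √(p * κ) with hσ
  have hσ0 : 0 < σ := by positivity
  have hσ2 : σ ^ 2 = p * κ := sq_sqrt (by positivity)
  have hsmall : ∀ w ∈ Set.Icc (v - 1 / σ) (v + 1 / σ), κ * (w - v) ^ 2 ≤ 1 / 4 := fun w hw => by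
    have h1 : (w - v) ^ 2 ≤ (1 / σ) ^ 2 := sq_le_sq' (by linarith [hw.1]) (by linarith [hw.2])
    have h2 : κ * (1 / σ) ^ 2 = 1 / p := by
      rw [div_pow, hσ2]; field_simp
    have h3 : 1 / p ≤ 1 / 4 := one_div_le_one_div_of_le (by norm_num) hp
    nlinarith
  have hlow : ∀ w ∈ Set.Icc (v - 1 / σ) (v + 1 / σ), w ∈ Set.Icc (-1 : ℝ) 1 ∧
      M * (1 - p * κ * (w - v) ^ 2) ≤ (1 - w ^ 2) ^ p * exp (p * (q * w)) := fun w hw => by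
    have hs := hsmall w hw
    have hb := le_tilted_base (t := w - v) hv hs
    rw [add_sub_cancel] at hb
    have hl0 : 0 < (1 - v ^ 2) * exp (q * v) * (1 - κ * (w - v) ^ 2) :=
      mul_pos (by positivity) (by linarith)
    have hw0 : 0 ≤ 1 - w ^ 2 := (pos_of_mul_pos_left (hl0.trans_le hb) (exp_pos _).le).le
    refine ⟨abs_le.mp (by rw [← sq_le_one_iff_abs_le_one]; linarith), ?_⟩
    rw [hform w hw0]
    have hbern := one_add_mul_self_le_rpow_one_add (s := -(κ * (w - v) ^ 2)) (by linarith)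
      (show 1 ≤ p by linarith)
    calc M * (1 - p * κ * (w - v) ^ 2)
        ≤ M * (1 - κ * (w - v) ^ 2) ^ p := by
          gcongr; refine le_trans (le_of_eq (by ring)) hbern
      _ = ((1 - v ^ 2) * exp (q * v) * (1 - κ * (w - v) ^ 2)) ^ p := by
          rw [hM, ← mul_rpow (by positivity) (by linarith)]
      _ ≤ _ := rpow_le_rpow hl0.le hb hp0.le
  have hcont : Continuous fun w : ℝ => (1 - w ^ 2) ^ p * exp (p * (q * w)) :=
    (Continuous.rpow_const (by fun_prop) fun _ => Or.inr hp0.le).mul (by fun_prop)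
  have hint : 4 / 3 * (1 / σ) * M ≤
      ∫ w in Set.Icc (-1 : ℝ) 1, (1 - w ^ 2) ^ p * exp (p * (q * w)) := by
    calc 4 / 3 * (1 / σ) * M
        = ∫ w in Set.Icc (v - 1 / σ) (v + 1 / σ), M * (1 - p * κ * (w - v) ^ 2) := by
          have hle : v - 1 / σ ≤ v + 1 / σ := by
            have : 0 < 1 / σ := by positivity
            linarith
          rw [integral_Icc_eq_integral_Ioc, ← intervalIntegral.integral_of_le hle,
            intervalIntegral.integral_comp_sub_right (fun w => M * (1 - p * κ * w ^ 2)),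
            intervalIntegral.integral_const_mul, intervalIntegral.integral_sub (by simp)
              (Continuous.intervalIntegrable (by fun_prop) _ _),
            intervalIntegral.integral_const_mul, integral_pow, ← hσ2]
          simp only [intervalIntegral.integral_const, smul_eq_mul, add_sub_cancel_left,
            sub_sub_cancel_left]
          rw [show (-(1 / σ)) ^ (2 + 1) = -(1 / σ) ^ (2 + 1) by ring]
          norm_num
          field_simp
          norm_num
      _ ≤ ∫ w in Set.Icc (v - 1 / σ) (v + 1 / σ), (1 - w ^ 2) ^ p * exp (p * (q * w)) :=
          setIntegral_mono_on (Continuous.integrableOn_Icc (by fun_prop))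
            hcont.integrableOn_Icc measurableSet_Icc fun w hw => (hlow w hw).2
      _ ≤ _ := setIntegral_mono_set hcont.integrableOn_Icc
          ((ae_restrict_iff' measurableSet_Icc).mpr <| .of_forall fun w hw =>
            mul_nonneg (rpow_nonneg (hsq w hw) _) (exp_pos _).le)
          (LE.le.eventuallyLE fun w hw => (hlow w hw).1)
  calc _ ≤ M := hupper
    _ = 3 / 4 * σ * (4 / 3 * (1 / σ) * M) := by field_simp
    _ ≤ _ := by gcongr

/-- Closed form of `L` in terms of `r = √(1 + 4Ps)`. -/
lemma L_eq {P s : ℝ} (hP : 0 < P) (hs : 0 < s) :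
    L P s = √(√(1 + 4 * P * s) * (√(1 + 4 * P * s) + 1) ^ 4 / (32 * π)) := by
  have hPs : 0 < P * s := mul_pos hP hs
  set r := √(1 + 4 * P * s) with hr
  have hr2 : r ^ 2 = 1 + 4 * P * s := sq_sqrt (by nlinarith)
  have hr1 : 1 < r := by rw [hr, lt_sqrt] <;> nlinarith
  have hr1' : r - 1 ≠ 0 := by linarith
  have h2 : 2 * P * s = (r - 1) * (r + 1) / 2 := by linarith
  have hpos : 0 ≤ 2 * P * s := by linarith
  rw [L, ← hr, ← hr2, ← sqrt_sq (sq_nonneg (2 * P * s)), ← sqrt_div (by positivity),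
    ← sqrt_mul (by positivity), h2]
  congr 1
  field_simp
  ring

/-- The supremum of the normalized density of `U` is at most `2 L √n` once `n ≥ 100`. -/
lemma g_le_integral {P s : ℝ} (hP : 0 < P) (hs : 0 < s) {n : ℕ} (hn : 100 ≤ n) {u : ℝ}
    (hu : u ∈ Set.Icc (-1 : ℝ) 1) :
    g P s n u ≤ 2 * L P s * √n * ∫ u in Set.Icc (-1 : ℝ) 1, g P s n u := by
  have hPs : 0 < P * s := mul_pos hP hs
  have hn' : (100 : ℝ) ≤ n := by exact_mod_cast hn
  have hn0 : (0 : ℝ) ≤ n := n.cast_nonneg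
  have hm : (0 : ℝ) < n - 3 := by linarith
  set θ : ℝ := n / (n - 3) with hθ
  have hθ1 : 1 ≤ θ := by rw [hθ, le_div_iff₀ hm]; linarith
  have hθ2 : θ ≤ 1.04 := by rw [hθ, div_le_iff₀ hm]; linarith
  set c := √(P * s) with hc
  have hc2 : c ^ 2 = P * s := sq_sqrt hPs.le
  set R := √(1 + 4 * (θ * c) ^ 2) with hR
  have hR2 : R ^ 2 = 1 + 4 * (θ * c) ^ 2 := sq_sqrt (by positivity)
  have hR0 : 0 ≤ R := sqrt_nonneg _
  set r := √(1 + 4 * P * s) with hr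
  have hr2 : r ^ 2 = 1 + 4 * P * s := sq_sqrt (by nlinarith)
  have hr1 : 1 ≤ r := by rw [hr, one_le_sqrt]; nlinarith
  have hRr : R ≤ θ * r := by
    refine abs_le_of_sq_le_sq' ?_ (by positivity) |>.2
    rw [hR2, mul_pow, mul_pow, hr2, hc2]
    nlinarith
  set v := 2 * (θ * c) / (R + 1) with hv
  have hv2 : 1 - v ^ 2 = 2 / (R + 1) := by
    rw [hv, div_pow, mul_pow]; field_simp; linarith
  have hvw : 2 * v / (1 - v ^ 2) = 2 * (θ * c) := by
    rw [hv2, hv]; field_simp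
  have hκ : 2 * (1 + v ^ 2) / (1 - v ^ 2) ^ 2 = R * (R + 1) := by
    rw [show 1 + v ^ 2 = 2 - (1 - v ^ 2) by ring, hv2]; field_simp; ring
  have hv1 : v ^ 2 < 1 := by
    have : 0 < 2 / (R + 1) := by positivity
    linarith
  have hg : ∀ w, g P s n w =
      (1 - w ^ 2) ^ (((n : ℝ) - 3) / 2) *
        exp (((n : ℝ) - 3) / 2 * (2 * v / (1 - v ^ 2) * w)) := fun w => by
    rw [g, ← hc, hvw, hθ]; congr 2; field_simp
  have hconst : 3 / 4 * √(((n : ℝ) - 3) / 2 * (R * (R + 1))) ≤ 2 * L P s * √n := by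
    refine abs_le_of_sq_le_sq' ?_ (mul_nonneg (by rw [L_eq hP hs]; positivity) (by positivity)) |>.2
    rw [L_eq hP hs, ← hr, mul_pow, mul_pow, mul_pow, sq_sqrt (by positivity),
      sq_sqrt (by positivity), sq_sqrt (by positivity)]
    have hRR : R * (R + 1) ≤ 1.0816 * (r * (r + 1)) := by
      calc R * (R + 1) ≤ 1.04 * r * (1.04 * r + 1.04) := by
            have : R ≤ 1.04 * r := hRr.trans (by gcongr)
            gcongr; norm_num
        _ = _ := by ring
    have hr4 : 8 * (r * (r + 1)) ≤ r * (r + 1) ^ 4 := by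
      have : (2 : ℝ) ^ 3 ≤ (r + 1) ^ 3 := by gcongr; linarith
      nlinarith [mul_le_mul_of_nonneg_left this (show 0 ≤ r * (r + 1) by positivity)]
    have hπ : r * (r + 1) ^ 4 / (32 * 3.15) ≤ r * (r + 1) ^ 4 / (32 * π) := by
      gcongr; exact pi_lt_d2.le
    have hrr : 0 ≤ r * (r + 1) := by positivity
    calc (3 / 4 : ℝ) ^ 2 * (((n : ℝ) - 3) / 2 * (R * (R + 1)))
        ≤ (3 / 4 : ℝ) ^ 2 * ((n : ℝ) / 2 * (1.0816 * (r * (r + 1)))) := by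
          gcongr; linarith
      _ ≤ 2 ^ 2 * (8 * (r * (r + 1)) / (32 * 3.15)) * n := by
          have : 0 ≤ r * (r + 1) * n := by positivity
          norm_num1
          linarith
      _ ≤ 2 ^ 2 * (r * (r + 1) ^ 4 / (32 * π)) * n := by
          refine mul_le_mul_of_nonneg_right (mul_le_mul_of_nonneg_left ?_ (by norm_num)) hn0
          exact le_trans (by gcongr) hπ
  simp only [hg]
  refine (tilted_le_integral (by linarith) hv1 hu).trans ?_
  rw [hκ]
  refine mul_le_mul_of_nonneg_right hconst (setIntegral_nonneg measurableSet_Icc fun w hw => ?_)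
  exact mul_nonneg (rpow_nonneg (by nlinarith [hw.1, hw.2]) _) (exp_pos _).le

lemma continuous_g (P s : ℝ) {n : ℕ} (hn : 3 ≤ n) : Continuous (g P s n) := by
  have : (3 : ℝ) ≤ n := by exact_mod_cast hn
  exact (Continuous.rpow_const (by fun_prop) fun _ => Or.inr (by linarith)).mul (by fun_prop)

lemma g_nonneg (P s : ℝ) (n : ℕ) {u : ℝ} (hu : u ∈ Set.Icc (-1 : ℝ) 1) : 0 ≤ g P s n u :=
  mul_nonneg (rpow_nonneg (by nlinarith [hu.1, hu.2]) _) (exp_pos _).le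

lemma integral_g_pos {P s : ℝ} (hP : 0 < P) (hs : 0 < s) {n : ℕ} (hn : 100 ≤ n) :
    0 < ∫ u in Set.Icc (-1 : ℝ) 1, g P s n u := by
  have h0 : g P s n 0 = 1 := by simp [g]
  have h := g_le_integral hP hs hn (u := 0) (by simp)
  rw [h0] at h
  exact pos_of_mul_pos_right (one_pos.trans_le h) (by rw [L_eq hP hs]; positivity)

/-- Tonelli's theorem for a product of functions of the separate coordinates. -/
lemma lintegral_prod_eval {ι : Type*} [Fintype ι] [DecidableEq ι] {f : ι → ℝ → ℝ≥0∞}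
    (hf : ∀ j, Measurable (f j)) :
    ∫⁻ u : ι → ℝ, ∏ j, f j (u j) = ∏ j, ∫⁻ x, f j x := by
  have hmeas : Measurable fun u : ι → ℝ => ∏ j, f j (u j) :=
    Finset.measurable_prod _ fun j _ => (hf j).comp (measurable_pi_apply j)
  have key : ∀ (t : Finset ι) (u : ι → ℝ),
      (∫⋯∫⁻_t, (fun u => ∏ j, f j (u j)) ∂fun _ => volume) u =
        (∏ j ∈ t, ∫⁻ x, f j x) * ∏ j ∈ tᶜ, f j (u j) := by
    intro t
    induction t using Finset.induction_on with
    | empty => simp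
    | insert i t hi ih =>
      intro u
      have hit : i ∈ tᶜ := Finset.mem_compl.mpr hi
      rw [lmarginal_insert _ hmeas hi, Finset.prod_insert hi, Finset.compl_insert]
      have hstep : ∀ x, (∏ j ∈ t, ∫⁻ x, f j x) * ∏ j ∈ tᶜ, f j (Function.update u i x j) =
          (∏ j ∈ t, ∫⁻ x, f j x) * (∏ j ∈ tᶜ.erase i, f j (u j)) * f i x := fun x => by
        rw [← Finset.mul_prod_erase _ _ hit, Function.update_self, mul_assoc, mul_comm (f i x)]
        congr 2
        exact Finset.prod_congr rfl fun j hj => by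
          rw [Function.update_of_ne (Finset.ne_of_mem_erase hj)]
      simp only [ih, hstep]
      rw [lintegral_const_mul _ (hf i)]
      ring
  have h := key Finset.univ 0
  rw [← lintegral_eq_lmarginal_univ] at h
  simpa [volume_pi] using h

/-- A bound on a single marginal density bounds interval probabilities of a linear form under a
product density. -/
lemma lintegral_prod_indicator_le {ι : Type*} [Fintype ι] [DecidableEq ι] (l : ι)
    {f : ι → ℝ → ℝ≥0∞} (hf : ∀ j, Measurable (f j)) {C : ℝ≥0∞}
    (hC : ∀ x, f l x ≤ C * ∫⁻ y, f l y) {c : ι → ℝ} (hc : 0 < c l) (a b : ℝ) :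
    ∫⁻ u : ι → ℝ, {u : ι → ℝ | ∑ j, c j * u j ∈ Set.Icc a b}.indicator (fun u => ∏ j, f j (u j)) u
      ≤ C * ENNReal.ofReal ((b - a) / c l) * ∏ j, ∫⁻ x, f j x := by
  have hmeas : Measurable fun u : ι → ℝ => ∏ j, f j (u j) :=
    Finset.measurable_prod _ fun j _ => (hf j).comp (measurable_pi_apply j)
  have hS : MeasurableSet {u : ι → ℝ | ∑ j, c j * u j ∈ Set.Icc a b} :=
    measurableSet_Icc.preimage (by fun_prop)
  have hprod : ∀ (u : ι → ℝ) x, ∏ j, f j (Function.update u l x j) =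
      f l x * ∏ j ∈ Finset.univ.erase l, f j (u j) := fun u x => by
    rw [← Finset.mul_prod_erase _ _ (Finset.mem_univ l), Function.update_self]
    congr 1
    exact Finset.prod_congr rfl fun j hj => by rw [Function.update_of_ne (Finset.ne_of_mem_erase hj)]
  have hsum : ∀ (u : ι → ℝ) x, ∑ j, c j * Function.update u l x j =
      c l * x + ∑ j ∈ Finset.univ.erase l, c j * u j := fun u x => by
    rw [← Finset.add_sum_erase _ _ (Finset.mem_univ l), Function.update_self]
    congr 1
    exact Finset.sum_congr rfl fun j hj => by rw [Function.update_of_ne (Finset.ne_of_mem_erase hj)]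
  rw [← lintegral_prod_eval hf, ← lintegral_const_mul _ hmeas]
  refine lintegral_le_of_lmarginal_le (μ := fun _ : ι => (volume : Measure ℝ)) {l}
    (hmeas.indicator hS) (hmeas.const_mul _) fun u => ?_
  rw [lmarginal_singleton, lmarginal_singleton]
  simp only [hprod]
  set D := ∑ j ∈ Finset.univ.erase l, c j * u j
  set Q := ∏ j ∈ Finset.univ.erase l, f j (u j)
  set I := Set.Icc ((a - D) / c l) ((b - D) / c l)
  calc ∫⁻ x, {u : ι → ℝ | ∑ j, c j * u j ∈ Set.Icc a b}.indicator (fun u => ∏ j, f j (u j))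
        (Function.update u l x)
      ≤ ∫⁻ x, I.indicator (fun _ => C * (∫⁻ y, f l y) * Q) x := by
        refine lintegral_mono fun x => ?_
        by_cases hx : x ∈ I
        · rw [Set.indicator_of_mem hx]
          refine (Set.indicator_le_self _ _ _).trans ?_
          rw [hprod]
          gcongr
          exact hC x
        · rw [Set.indicator_of_notMem]
          · exact zero_le
          · intro h
            rw [Set.mem_ofPred_eq, hsum, Set.mem_Icc] at h
            refine hx ⟨(div_le_iff₀ hc).mpr ?_, (le_div_iff₀ hc).mpr ?_⟩ <;> linarith [h.1, h.2]
    _ = C * (∫⁻ y, f l y) * Q * ENNReal.ofReal ((b - a) / c l) := by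
        rw [lintegral_indicator_const measurableSet_Icc, Real.volume_Icc]
        congr 2
        ring
    _ = ∫⁻ x, C * ENNReal.ofReal ((b - a) / c l) * (f l x * Q) := by
        rw [lintegral_const_mul _ ((hf l).mul_const _), lintegral_mul_const _ (hf l)]
        ring

/-- Interval probabilities under `jointLaw`, from a bound `C` on one marginal density. -/
lemma jointLaw_apply_le {k n : ℕ} {Pc : Finset (Fin k)} {P s : Fin k → ℝ}
    (hP : ∀ j ∈ Pc, 0 < P j) (hs : ∀ j ∈ Pc, 0 < s j) (hn : 100 ≤ n) (l : {j // j ∈ Pc})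
    {C : ℝ} (hC0 : 0 ≤ C) (hC : ∀ u ∈ Set.Icc (-1 : ℝ) 1,
      g (P l) (s l) n u ≤ C * ∫ u in Set.Icc (-1 : ℝ) 1, g (P l) (s l) n u) (a b : ℝ) :
    jointLaw Pc P s n {u | ∑ j : {j // j ∈ Pc}, √(P j * s j) * u j ∈ Set.Icc a b} ≤
      ENNReal.ofReal (C * ((b - a) / √(P l * s l))) := by
  have hcont : ∀ j, Continuous (g (P j) (s j) n) := fun j => continuous_g _ _ (by omega)
  set f : {j // j ∈ Pc} → ℝ → ℝ≥0∞ := fun j =>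
    (Set.Icc (-1 : ℝ) 1).indicator fun u => ENNReal.ofReal (g (P j) (s j) n u) with hfdef
  set Z : {j // j ∈ Pc} → ℝ := fun j => ∫ u in Set.Icc (-1 : ℝ) 1, g (P j) (s j) n u with hZdef
  have hZ : ∀ j, 0 < Z j := fun j => integral_g_pos (hP j j.2) (hs j j.2) hn
  have hf : ∀ j, Measurable (f j) := fun j =>
    (hcont j).measurable.ennreal_ofReal.indicator measurableSet_Icc
  have hfZ : ∀ j, ∫⁻ x, f j x = ENNReal.ofReal (Z j) := fun j => by
    rw [lintegral_indicator measurableSet_Icc, hZdef,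
      ofReal_integral_eq_lintegral_ofReal (hcont j).integrableOn_Icc]
    exact (ae_restrict_iff' measurableSet_Icc).mpr (.of_forall fun u hu => g_nonneg _ _ _ hu)
  have hPs : 0 < √(P l * s l) := sqrt_pos.mpr (mul_pos (hP l l.2) (hs l l.2))
  have hfC : ∀ x, f l x ≤ ENNReal.ofReal C * ∫⁻ y, f l y := fun x => by
    rw [hfZ, ← ENNReal.ofReal_mul hC0]
    exact Set.indicator_le' (fun u hu => ENNReal.ofReal_le_ofReal (hC u hu))
      (fun _ _ => zero_le) x
  have hmain := lintegral_prod_indicator_le l hf hfC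
    (c := fun j : {j // j ∈ Pc} => √(P j * s j)) hPs a b
  set S : Set ({j // j ∈ Pc} → ℝ) :=
    {u | ∑ j : {j // j ∈ Pc}, √(P j * s j) * u j ∈ Set.Icc a b}
  have hS : MeasurableSet S := measurableSet_Icc.preimage (by fun_prop)
  have hbox : MeasurableSet (Set.univ.pi fun _ : {j // j ∈ Pc} => Set.Icc (-1 : ℝ) 1) :=
    MeasurableSet.univ_pi fun _ => measurableSet_Icc
  have hdens : (Set.univ.pi fun _ : {j // j ∈ Pc} => Set.Icc (-1 : ℝ) 1).indicator
      (fun u => ENNReal.ofReal (∏ j : {j // j ∈ Pc}, g (P j) (s j) n (u j))) =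
        fun u => ∏ j, f j (u j) := by
    funext u
    by_cases hu : u ∈ Set.univ.pi fun _ : {j // j ∈ Pc} => Set.Icc (-1 : ℝ) 1
    · rw [Set.indicator_of_mem hu,
        ENNReal.ofReal_prod_of_nonneg fun j _ => g_nonneg _ _ _ (hu j trivial)]
      refine Finset.prod_congr rfl fun j _ => ?_
      simp only [hfdef]
      rw [Set.indicator_of_mem (hu j trivial)]
    · rw [Set.indicator_of_notMem hu]
      simp only [Set.mem_univ_pi, not_forall] at hu
      obtain ⟨j, hj⟩ := hu
      exact (Finset.prod_eq_zero (Finset.mem_univ j) (Set.indicator_of_notMem hj _)).symm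
  have hZprod : 0 < ∏ j, Z j := Finset.prod_pos fun j _ => hZ j
  have hint : (volume.restrict
      (Set.univ.pi fun _ : {j // j ∈ Pc} => Set.Icc (-1 : ℝ) 1)).withDensity
        (fun u => ENNReal.ofReal (∏ j : {j // j ∈ Pc}, g (P j) (s j) n (u j))) S =
      ∫⁻ u, S.indicator (fun u => ∏ j, f j (u j)) u := by
    rw [withDensity_apply _ hS, Measure.restrict_restrict hS, Set.inter_comm,
      ← Measure.restrict_restrict hbox, ← lintegral_indicator hbox, hdens, ← lintegral_indicator hS]
  rw [jointLaw, Measure.smul_apply, smul_eq_mul, hint]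
  have hne0 : ENNReal.ofReal (∏ j, Z j) ≠ 0 := (ENNReal.ofReal_pos.mpr hZprod).ne'
  refine (mul_le_mul_right hmain _).trans (le_of_eq ?_)
  simp only [hfZ]
  rw [← ENNReal.ofReal_prod_of_nonneg fun j _ => (hZ j).le, mul_comm, mul_assoc,
    ENNReal.mul_inv_cancel hne0 ENNReal.ofReal_ne_top, mul_one, ← ENNReal.ofReal_mul hC0]

/-- Parallel-channels version of the interval-probability estimate: for independent `U_j`
with the tilted-sphere densities, the probability that `∑_{j∈Pc} √(P_j s_j) U_j` lies in
`[a/n, (a+μ)/n]` is at most `min_{l∈Pc} 2 L(P_l, s_l) μ / √(n P_l s_l)` for large `n`. -/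
theorem parallel_interval_bound (k : ℕ) (hk : 1 ≤ k) (Pc : Finset (Fin k)) (hPc : Pc.Nonempty)
    (P s : Fin k → ℝ) (hP : ∀ j ∈ Pc, 0 < P j) (hs : ∀ j ∈ Pc, 0 < s j) :
    ∃ N : ℕ, ∀ n : ℕ, n ≥ N → ∀ a μ : ℝ, 0 < μ →
      (jointLaw Pc P s n {u | (∑ j : {j // j ∈ Pc}, Real.sqrt (P j * s j) * u j) ∈
          Set.Icc (a / n) ((a + μ) / n)}).toReal
        ≤ Pc.inf' hPc fun l => 2 * L (P l) (s l) * μ / Real.sqrt (n * P l * s l) := by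
  refine ⟨100, fun n hn a μ hμ => Finset.le_inf' _ _ fun l hl => ?_⟩
  have hn0 : (0 : ℝ) < n := by
    have : (100 : ℝ) ≤ n := by exact_mod_cast hn
    linarith
  have hL : 0 ≤ L (P l) (s l) := by
    rw [L_eq (hP l hl) (hs l hl)]
    positivity
  have hPs : 0 < √(P l * s l) := sqrt_pos.mpr (mul_pos (hP l hl) (hs l hl))
  refine ENNReal.toReal_le_of_le_ofReal (by positivity) ?_
  refine (jointLaw_apply_le hP hs hn ⟨l, hl⟩ (by positivity : 0 ≤ 2 * L (P l) (s l) * √n)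
    (fun u hu => g_le_integral (hP l hl) (hs l hl) hn hu) _ _).trans (le_of_eq ?_)
  congr 1
  have hsq : √(n : ℝ) ^ 2 = n := sq_sqrt hn0.le
  rw [mul_assoc (n : ℝ), sqrt_mul hn0.le]
  field_simp
  rw [hsq]
  ring

end
end

section
/- For every ε ∈ (0,1) and every P ∈ (0,∞), there exist a constant c > 0 and N ∈ ℕ such that for all n ≥ N there exists a code of size M with log M ≥ n·C(P) + √(n·V(P))·Φ⁻¹(ε) + (1/2)·log n − c, whose codewords all satisfy the equal power constraint ‖x(m)‖₂² = nP exactly, with pairwise disjoint decoding regions and average error probability at most ε over the AWGN channel Wⁿ. -/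
open MeasureTheory ProbabilityTheory Real
open scoped ENNReal

noncomputable section

/-- Gaussian capacity `C(P) = (1/2) log(1+P)` (natural logarithm). -/
def gaussC (P : ℝ) : ℝ := Real.log (1 + P) / 2

/-- Gaussian dispersion `V(P) = P(P+2)/(2(P+1)^2)` (in nats). -/
def gaussV (P : ℝ) : ℝ := P * (P + 2) / (2 * (P + 1) ^ 2)

/-- Standard normal cumulative distribution function. -/
def Phi (a : ℝ) : ℝ := ∫ u in Set.Iic a, (Real.sqrt (2 * π))⁻¹ * Real.exp (-u ^ 2 / 2)

/-- Inverse of the standard normal CDF, `Φ⁻¹(ε) = sup {a : Φ(a) ≤ ε}`. -/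
def PhiInv (ε : ℝ) : ℝ := sSup {a : ℝ | Phi a ≤ ε}

/-- The `n`-fold AWGN channel with unit noise variance: `Wn n x D` is the probability
that `x + Z ∈ D` where `Z` is an i.i.d. standard Gaussian vector. -/
def Wn (n : ℕ) (x : Fin n → ℝ) (D : Set (Fin n → ℝ)) : ℝ≥0∞ :=
  (Measure.pi fun _ : Fin n => gaussianReal 0 1) {z | (fun i => x i + z i) ∈ D}

/-- The law of the squared norm of a standard Gaussian vector in `ℝᵐ`. -/
def chiSq (m : ℕ) : Measure ℝ :=
  (Measure.pi fun _ : Fin m => gaussianReal 0 1).map fun z => ∑ i, z i ^ 2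

instance isProbabilityMeasure_chiSq (m : ℕ) : IsProbabilityMeasure (chiSq m) :=
  Measure.isProbabilityMeasure_map (Measurable.aemeasurable (by fun_prop))

lemma map_pi_head_tail (m : ℕ) :
    (Measure.pi fun _ : Fin (m + 1) => gaussianReal 0 1).map
      (fun z => (z 0, ∑ i : Fin m, z i.succ ^ 2)) = (gaussianReal 0 1).prod (chiSq m) := by
  have h := (measurePreserving_piFinSuccAbove (fun _ : Fin (m + 1) => gaussianReal 0 1) 0).map_eq
  have h2 : (gaussianReal 0 1).prod (chiSq m) =
      ((gaussianReal 0 1).prod (Measure.pi fun _ : Fin m => gaussianReal 0 1)).map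
        (Prod.map id fun z => ∑ i, z i ^ 2) := by
    rw [← Measure.map_prod_map _ _ measurable_id (by fun_prop), Measure.map_id]
    rfl
  rw [h2, ← h, Measure.map_map (by fun_prop) (by fun_prop)]
  rfl

lemma map_pi_inner_residual {m : ℕ} (u : Fin (m + 1) → ℝ) (hu : ∑ i, u i ^ 2 = 1) :
    (Measure.pi fun _ : Fin (m + 1) => gaussianReal 0 1).map
      (fun z => (∑ i, u i * z i, ∑ i, z i ^ 2 - (∑ i, u i * z i) ^ 2)) =
      (gaussianReal 0 1).prod (chiSq m) := by
  set U : EuclideanSpace ℝ (Fin (m + 1)) := WithLp.toLp 2 u with hU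
  set e : EuclideanSpace ℝ (Fin (m + 1)) := EuclideanSpace.single 0 1 with he
  have hnorm : ‖U‖ = ‖e‖ := by
    rw [EuclideanSpace.norm_eq]
    simp [hU, he, hu]
  set f : EuclideanSpace ℝ (Fin (m + 1)) ≃ₗᵢ[ℝ] EuclideanSpace ℝ (Fin (m + 1)) :=
    (ℝ ∙ (U - e))ᗮ.reflection with hf
  have hfU : f U = e := Submodule.reflection_sub hnorm
  set F : EuclideanSpace ℝ (Fin (m + 1)) → ℝ × ℝ := fun w => (w 0, ‖w‖ ^ 2 - w 0 ^ 2) with hF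
  have hFm : Measurable F := by fun_prop
  have h1 : (fun z : Fin (m + 1) → ℝ =>
      (∑ i, u i * z i, ∑ i, z i ^ 2 - (∑ i, u i * z i) ^ 2)) = F ∘ f ∘ WithLp.toLp 2 := by
    funext z
    have h0 : (f (WithLp.toLp 2 z)) 0 = ∑ i, u i * z i := by
      have : inner ℝ (f U) (f (WithLp.toLp 2 z)) = inner ℝ U (WithLp.toLp 2 z) :=
        f.inner_map_map _ _
      rw [hfU] at this
      simpa [he, hU, PiLp.inner_apply, mul_comm] using this
    have h2 : ‖f (WithLp.toLp 2 z)‖ ^ 2 = ∑ i, z i ^ 2 := by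
      rw [f.norm_map, EuclideanSpace.real_norm_sq_eq]
    simp only [Function.comp, hF, h0, h2]
  have h3 : (fun z : Fin (m + 1) → ℝ => (z 0, ∑ i : Fin m, z i.succ ^ 2)) =
      F ∘ WithLp.toLp 2 := by
    funext z
    simp only [Function.comp, hF, EuclideanSpace.real_norm_sq_eq, Fin.sum_univ_succ]
    simp
  rw [← map_pi_head_tail, h1, h3, ← Measure.map_map hFm (by fun_prop),
    ← Measure.map_map hFm (by fun_prop), ← Measure.map_map (by fun_prop) (by fun_prop),
    map_pi_eq_stdGaussian, stdGaussian_map]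

lemma chiSq_succ (m : ℕ) :
    chiSq (m + 1) = ((gaussianReal 0 1).prod (chiSq m)).map fun p => p.1 ^ 2 + p.2 := by
  rw [← map_pi_head_tail, Measure.map_map (by fun_prop) (by fun_prop), chiSq]
  congr 1
  funext z
  simp [Fin.sum_univ_succ]

lemma lintegral_exp_neg_mul_sq_gaussianReal {l : ℝ} (hl : 0 < 1 + 2 * l) :
    ∫⁻ z, ENNReal.ofReal (exp (-l * z ^ 2)) ∂gaussianReal 0 1 =
      ENNReal.ofReal ((1 + 2 * l) ^ (-(1 : ℝ) / 2)) := by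
  have hb : 0 < (1 + 2 * l) / 2 := by linarith
  rw [gaussianReal_of_var_ne_zero _ one_ne_zero, lintegral_withDensity_eq_lintegral_mul _
    (measurable_gaussianPDF _ _) (by fun_prop)]
  have : ∀ z : ℝ, (gaussianPDF 0 1 * fun z => ENNReal.ofReal (exp (-l * z ^ 2))) z =
      ENNReal.ofReal ((√(2 * π))⁻¹ * exp (-((1 + 2 * l) / 2) * z ^ 2)) := by
    intro z
    simp only [Pi.mul_apply, gaussianPDF, gaussianPDFReal]
    rw [← ENNReal.ofReal_mul (by positivity), mul_assoc, ← exp_add]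
    congr 3
    · simp
    · simp; ring
  simp_rw [this]
  rw [← ofReal_integral_eq_lintegral_ofReal ((integrable_exp_neg_mul_sq hb).const_mul _)
    (Filter.Eventually.of_forall fun z => by positivity), integral_const_mul, integral_gaussian]
  congr 1
  rw [← sqrt_inv, ← sqrt_mul (by positivity)]
  rw [neg_div, rpow_neg hl.le, ← sqrt_eq_rpow, ← sqrt_inv]
  congr 1
  have := pi_pos.ne'
  field_simp

lemma lintegral_exp_neg_mul_chiSq (m : ℕ) {l : ℝ} (hl : 0 < 1 + 2 * l) :
    ∫⁻ r, ENNReal.ofReal (exp (-l * r)) ∂chiSq m =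
      ENNReal.ofReal ((1 + 2 * l) ^ (-(m : ℝ) / 2)) := by
  induction m with
  | zero => simp [chiSq]
  | succ m ih =>
    rw [chiSq_succ, lintegral_map (by fun_prop) (by fun_prop), lintegral_prod _ (by fun_prop)]
    have : ∀ z r : ℝ, ENNReal.ofReal (exp (-l * (z ^ 2 + r))) =
        ENNReal.ofReal (exp (-l * z ^ 2)) * ENNReal.ofReal (exp (-l * r)) := by
      intro z r
      rw [← ENNReal.ofReal_mul (by positivity), ← exp_add, mul_add]
    simp_rw [this]
    simp_rw [lintegral_const_mul _ (show Measurable fun r => ENNReal.ofReal (exp (-l * r)) by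
      fun_prop), ih]
    rw [lintegral_mul_const _ (by fun_prop), lintegral_exp_neg_mul_sq_gaussianReal hl,
      ← ENNReal.ofReal_mul (by positivity), ← rpow_add hl]
    congr 2
    push_cast
    ring

lemma ae_chiSq_pos {m : ℕ} (hm : m ≠ 0) : ∀ᵐ r ∂chiSq m, 0 < r := by
  obtain ⟨k, rfl⟩ := Nat.exists_eq_succ_of_ne_zero hm
  have : NullSingletonClass (gaussianReal 0 1) := nullSingletonClass_gaussianReal one_ne_zero
  rw [chiSq, ae_map_iff (Measurable.aemeasurable (by fun_prop)) measurableSet_Ioi]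
  have h : ∀ᵐ x ∂(gaussianReal 0 1), x ≠ 0 := by
    rw [ae_iff]; simp
  have h2 := (Measure.quasiMeasurePreserving_eval (fun _ : Fin (k + 1) => gaussianReal 0 1)
    0).ae h
  filter_upwards [h2] with z hz
  exact Finset.sum_pos' (fun i _ => sq_nonneg _) ⟨0, Finset.mem_univ _, by
    have : z 0 ≠ 0 := hz
    positivity⟩

lemma lintegral_sqrt_mul_exp_chiSq {m : ℕ} (hm : 2 ≤ m) (t : ℝ) :
    ∫⁻ r, ENNReal.ofReal (√r * exp (-(t ^ 2 / 2) * r)) ∂chiSq m ≤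
      ENNReal.ofReal (3 * √m * (1 + t ^ 2) ^ (-(m : ℝ) / 2)) := by
  have hm' : (2 : ℝ) ≤ m := by exact_mod_cast hm
  have hm0 : (0 : ℝ) < m := by linarith
  have hinv : 1 / (m : ℝ) ≤ 1 / 2 := one_div_le_one_div_of_le (by norm_num) hm'
  set l : ℝ := t ^ 2 / 2 - 1 / (2 * m) with hl
  have hl2 : 1 + 2 * l = 1 + t ^ 2 - 1 / m := by rw [hl]; field_simp; ring
  have hlpos : 0 < 1 + 2 * l := by rw [hl2]; nlinarith [sq_nonneg t]
  have hpt : ∀ r : ℝ, √r * exp (-(t ^ 2 / 2) * r) ≤ √m * exp (-l * r) := by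
    intro r
    have h1 : r ≤ m * exp (r / m) := by
      have := add_one_le_exp (r / m)
      calc r = m * (r / m) := by field_simp
        _ ≤ m * exp (r / m) := by gcongr; linarith
    have h2 : √r ≤ √m * exp (r / m / 2) := by
      rw [exp_half, ← sqrt_mul hm0.le]
      exact sqrt_le_sqrt h1
    calc √r * exp (-(t ^ 2 / 2) * r) ≤ √m * exp (r / m / 2) * exp (-(t ^ 2 / 2) * r) := by gcongr
      _ = √m * exp (-l * r) := by
        rw [mul_assoc, ← exp_add, hl]; congr 2; field_simp; ring
  have h3 : (1 + 2 * l) ^ (-(m : ℝ) / 2) ≤ 3 * (1 + t ^ 2) ^ (-(m : ℝ) / 2) := by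
    have ha : 0 < 1 - 1 / (m : ℝ) := by linarith
    have h4 : (1 - 1 / (m : ℝ)) ^ (-(m : ℝ) / 2) ≤ 3 := by
      have h5 : (1 - 1 / (m : ℝ))⁻¹ ≤ exp (2 / m) := by
        have := add_one_le_exp (2 / (m : ℝ))
        refine le_trans ?_ this
        rw [inv_le_comm₀ ha (by positivity), inv_eq_one_div, div_le_iff₀ (by positivity)]
        have : (1 - 1 / (m : ℝ)) * (2 / m + 1) = 1 + (1 / m) * (1 - 2 * (1 / m)) := by ring
        rw [this]
        have : 0 ≤ 1 / (m : ℝ) * (1 - 2 * (1 / m)) :=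
          mul_nonneg (by positivity) (by linarith)
        linarith
      calc (1 - 1 / (m : ℝ)) ^ (-(m : ℝ) / 2) = ((1 - 1 / (m : ℝ))⁻¹) ^ ((m : ℝ) / 2) := by
            rw [neg_div, rpow_neg ha.le, inv_rpow ha.le]
        _ ≤ (exp (2 / m)) ^ ((m : ℝ) / 2) := by gcongr
        _ = exp 1 := by rw [← exp_mul]; congr 1; field_simp
        _ ≤ 3 := exp_one_lt_three.le
    calc (1 + 2 * l) ^ (-(m : ℝ) / 2)
        ≤ ((1 - 1 / (m : ℝ)) * (1 + t ^ 2)) ^ (-(m : ℝ) / 2) := by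
          apply rpow_le_rpow_of_nonpos (by positivity) _ (by rw [neg_div]; simp; positivity)
          rw [hl2]
          have : 0 ≤ 1 / (m : ℝ) * t ^ 2 := by positivity
          linarith
      _ = (1 - 1 / (m : ℝ)) ^ (-(m : ℝ) / 2) * (1 + t ^ 2) ^ (-(m : ℝ) / 2) :=
          mul_rpow ha.le (by positivity)
      _ ≤ 3 * (1 + t ^ 2) ^ (-(m : ℝ) / 2) := by gcongr
  calc ∫⁻ r, ENNReal.ofReal (√r * exp (-(t ^ 2 / 2) * r)) ∂chiSq m
      ≤ ∫⁻ r, ENNReal.ofReal (√m) * ENNReal.ofReal (exp (-l * r)) ∂chiSq m := by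
        apply lintegral_mono
        intro r
        dsimp only
        rw [← ENNReal.ofReal_mul (by positivity)]
        exact ENNReal.ofReal_le_ofReal (hpt r)
    _ = ENNReal.ofReal (√m * (1 + 2 * l) ^ (-(m : ℝ) / 2)) := by
        rw [lintegral_const_mul _ (by fun_prop), lintegral_exp_neg_mul_chiSq m hlpos,
          ← ENNReal.ofReal_mul (by positivity)]
    _ ≤ _ := by
        apply ENNReal.ofReal_le_ofReal
        calc √m * (1 + 2 * l) ^ (-(m : ℝ) / 2)
            ≤ √m * (3 * (1 + t ^ 2) ^ (-(m : ℝ) / 2)) := by gcongr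
          _ = _ := by ring

lemma gaussianPDF_std_le (x : ℝ) : gaussianPDF 0 1 x ≤ ENNReal.ofReal (exp (-(x ^ 2) / 2)) := by
  simp only [gaussianPDF, gaussianPDFReal]
  apply ENNReal.ofReal_le_ofReal
  have h1 : (√(2 * π * ((1 : NNReal) : ℝ)))⁻¹ ≤ 1 := by
    apply inv_le_one_of_one_le₀
    rw [one_le_sqrt]
    simp only [NNReal.coe_one]
    nlinarith [pi_gt_three]
  have h2 : -(x - 0) ^ 2 / (2 * ((1 : NNReal) : ℝ)) = -(x ^ 2) / 2 := by simp
  rw [h2]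
  exact mul_le_of_le_one_left (exp_pos _).le h1

lemma gaussianReal_std_le_volume : gaussianReal 0 1 ≤ volume := by
  rw [gaussianReal_of_var_ne_zero _ one_ne_zero]
  calc volume.withDensity (gaussianPDF 0 1) ≤ volume.withDensity 1 := by
        apply withDensity_mono
        refine Filter.Eventually.of_forall fun x => (gaussianPDF_std_le x).trans ?_
        simp only [Pi.one_apply, ENNReal.ofReal_le_one, exp_le_one_iff]
        nlinarith [sq_nonneg x]
    _ = volume := withDensity_one

lemma lintegral_excess_gaussianReal_le {r : ℝ} (hr : 0 < r) (k : ℝ) :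
    ∫⁻ x, ENNReal.ofReal (x / √r - k) ∂gaussianReal 0 1 ≤
      ∫⁻ t, ENNReal.ofReal (t - k) * ENNReal.ofReal (√r * exp (-(t ^ 2 / 2) * r)) := by
  have hs : 0 < √r := sqrt_pos.2 hr
  rw [gaussianReal_of_var_ne_zero _ one_ne_zero, lintegral_withDensity_eq_lintegral_mul _
    (measurable_gaussianPDF _ _) (by fun_prop)]
  calc ∫⁻ x, (gaussianPDF 0 1 * fun x => ENNReal.ofReal (x / √r - k)) x
      ≤ ∫⁻ x, ENNReal.ofReal (exp (-(x ^ 2) / 2)) * ENNReal.ofReal (x / √r - k) := by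
        apply lintegral_mono
        intro x
        simp only [Pi.mul_apply]
        gcongr
        exact gaussianPDF_std_le x
    _ = _ := by
        conv_lhs => rw [← Real.smul_map_volume_mul_left hs.ne']
        rw [lintegral_smul_measure, lintegral_map (by fun_prop) (by fun_prop), smul_eq_mul,
          ← lintegral_const_mul _ (by fun_prop)]
        congr 1
        funext t
        rw [abs_of_pos hs, ENNReal.ofReal_mul hs.le, ← mul_assoc, mul_comm]
        congr 2
        · congr 1; field_simp
        · congr 2; rw [mul_pow, sq_sqrt hr.le]; ring

lemma lintegral_excess_rpow_le {m : ℕ} (hm : 8 ≤ m) {k : ℝ} (hk : 0 < k) :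
    ∫⁻ t, ENNReal.ofReal (t - k) * ENNReal.ofReal ((1 + t ^ 2) ^ (-(m : ℝ) / 2)) ≤
      ENNReal.ofReal (16 * ((1 + k ^ 2) / (2 * k)) ^ 2 / m ^ 2 * (1 + k ^ 2) ^ (-(m : ℝ) / 2)) := by
  have hm' : (8 : ℝ) ≤ m := by exact_mod_cast hm
  set b : ℝ := 2 * k / (1 + k ^ 2) with hb
  have hbpos : 0 < b := by positivity
  set a : ℝ := (m : ℝ) / 2 with ha
  have ha4 : 4 ≤ a := by rw [ha]; linarith
  have hw : ∀ t ∈ Set.Ici k, 0 < 1 + b * (t - k) := by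
    intro t ht
    have : 0 ≤ b * (t - k) := mul_nonneg hbpos.le (sub_nonneg.2 ht)
    linarith
  set G : ℝ → ℝ := fun t => (1 + b * (t - k)) ^ (1 - a) * (b ^ 2 * (a - 1))⁻¹ -
    (1 + b * (t - k)) ^ (2 - a) * (b ^ 2 * (a - 2))⁻¹ with hG
  set G' : ℝ → ℝ := fun t => (t - k) * (1 + b * (t - k)) ^ (-a) with hG'
  have hderiv : ∀ t ∈ Set.Ici k, HasDerivAt G (G' t) t := by
    intro t ht
    have hwt := hw t ht
    have hlin : HasDerivAt (fun t => 1 + b * (t - k)) b t := by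
      simpa using (((hasDerivAt_id t).sub_const k).const_mul b).const_add 1
    have h1 := (hlin.rpow_const (p := 1 - a) (Or.inl hwt.ne')).mul_const (b ^ 2 * (a - 1))⁻¹
    have h2 := (hlin.rpow_const (p := 2 - a) (Or.inl hwt.ne')).mul_const (b ^ 2 * (a - 2))⁻¹
    have h := h1.sub h2
    have e1 : (1 + b * (t - k)) ^ (2 - a - 1) =
        (1 + b * (t - k)) * (1 + b * (t - k)) ^ (-a) := by
      rw [← rpow_one_add' hwt.le (by linarith)]; congr 1; ring
    have e2 : (1 + b * (t - k)) ^ (1 - a - 1) = (1 + b * (t - k)) ^ (-a) := by congr 1; ring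
    rw [e1, e2] at h
    refine h.congr_deriv ?_
    rw [hG']
    have h3 : a - 1 ≠ 0 := by linarith
    have h4 : a - 2 ≠ 0 := by linarith
    field_simp
    ring
  have hnonneg : ∀ t ∈ Set.Ioi k, 0 ≤ G' t := by
    intro t ht
    exact mul_nonneg (sub_nonneg.2 (le_of_lt ht)) (rpow_nonneg (hw t (Set.mem_Ici_of_Ioi ht)).le _)
  have hlim : Filter.Tendsto G Filter.atTop (nhds 0) := by
    have hlin : Filter.Tendsto (fun t => 1 + b * (t - k)) Filter.atTop Filter.atTop :=
      Filter.tendsto_atTop_add_const_left _ _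
        ((Filter.tendsto_atTop_add_const_right _ _ Filter.tendsto_id).const_mul_atTop hbpos)
    have h1 := (tendsto_rpow_neg_atTop (show 0 < a - 1 by linarith)).comp hlin
    have h2 := (tendsto_rpow_neg_atTop (show 0 < a - 2 by linarith)).comp hlin
    have := (h1.mul_const (b ^ 2 * (a - 1))⁻¹).sub (h2.mul_const (b ^ 2 * (a - 2))⁻¹)
    simpa [Function.comp_def, hG] using this
  have hintegrable := integrableOn_Ioi_deriv_of_nonneg' hderiv hnonneg hlim
  have hval := integral_Ioi_of_hasDerivAt_of_nonneg' hderiv hnonneg hlim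
  have hGk : 0 - G k ≤ 16 * ((1 + k ^ 2) / (2 * k)) ^ 2 / m ^ 2 := by
    have hinvb : (1 + k ^ 2) / (2 * k) = b⁻¹ := by rw [hb, inv_div]
    have hma : (m : ℝ) = 2 * a := by rw [ha]; ring
    rw [hinvb, hma, hG]
    simp only [sub_self, mul_zero, add_zero, one_rpow, one_mul]
    have h3 : 0 < a - 1 := by linarith
    have h4 : 0 < a - 2 := by linarith
    have : 0 - ((b ^ 2 * (a - 1))⁻¹ - (b ^ 2 * (a - 2))⁻¹) =
        b⁻¹ ^ 2 * (1 / ((a - 1) * (a - 2))) := by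
      field_simp; ring
    rw [this]
    have : 1 / ((a - 1) * (a - 2)) ≤ 16 / (2 * a) ^ 2 := by
      rw [div_le_div_iff₀ (by positivity) (by positivity)]
      nlinarith
    calc b⁻¹ ^ 2 * (1 / ((a - 1) * (a - 2))) ≤ b⁻¹ ^ 2 * (16 / (2 * a) ^ 2) := by gcongr
      _ = _ := by ring
  calc ∫⁻ t, ENNReal.ofReal (t - k) * ENNReal.ofReal ((1 + t ^ 2) ^ (-(m : ℝ) / 2))
      = ∫⁻ t in Set.Ioi k,
          ENNReal.ofReal (t - k) * ENNReal.ofReal ((1 + t ^ 2) ^ (-(m : ℝ) / 2)) := by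
        rw [← lintegral_indicator measurableSet_Ioi]
        congr 1
        funext t
        by_cases ht : t ∈ Set.Ioi k
        · simp [ht]
        · rw [Set.indicator_of_notMem ht, ENNReal.ofReal_of_nonpos, zero_mul]
          simpa using ht
    _ ≤ ∫⁻ t in Set.Ioi k, ENNReal.ofReal ((1 + k ^ 2) ^ (-(m : ℝ) / 2)) *
          ENNReal.ofReal (G' t) := by
        apply setLIntegral_mono' measurableSet_Ioi
        intro t ht
        have ht0 : 0 < t - k := sub_pos.2 ht
        have hwt := hw t (Set.mem_Ici_of_Ioi ht)
        rw [← ENNReal.ofReal_mul ht0.le, ← ENNReal.ofReal_mul (by positivity)]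
        apply ENNReal.ofReal_le_ofReal
        have h5 : (1 + t ^ 2) ^ (-(m : ℝ) / 2) ≤
            ((1 + k ^ 2) * (1 + b * (t - k))) ^ (-(m : ℝ) / 2) := by
          apply rpow_le_rpow_of_nonpos (by positivity) _ (by rw [neg_div]; simp; positivity)
          have : (1 + k ^ 2) * (1 + b * (t - k)) = 1 + k ^ 2 + 2 * k * (t - k) := by
            rw [hb]; field_simp
          rw [this]
          nlinarith
        rw [mul_rpow (by positivity) hwt.le] at h5
        calc (t - k) * (1 + t ^ 2) ^ (-(m : ℝ) / 2)
            ≤ (t - k) * ((1 + k ^ 2) ^ (-(m : ℝ) / 2) *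
                (1 + b * (t - k)) ^ (-(m : ℝ) / 2)) := by gcongr
          _ = _ := by rw [hG', ha]; simp only [neg_div]; ring
    _ = ENNReal.ofReal ((1 + k ^ 2) ^ (-(m : ℝ) / 2) * (0 - G k)) := by
        rw [lintegral_const_mul' _ _ ENNReal.ofReal_ne_top, ← hval,
          ENNReal.ofReal_mul (by positivity), ofReal_integral_eq_lintegral_ofReal hintegrable
            ((ae_restrict_mem measurableSet_Ioi).mono hnonneg)]
    _ ≤ _ := by
        apply ENNReal.ofReal_le_ofReal
        rw [mul_comm]
        gcongr

/-- With `(z, r)` the component of the noise along the transmitted codeword of norm `a` and the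
squared norm of the rest of the noise, and `(x, s)` the analogous decomposition of an independent
Gaussian direction along the channel output: the event that the output is at angle less than
`arccot k` from the codeword while the independent direction is at least as close to the output. -/
def confusionSet (k a : ℝ) : Set ((ℝ × ℝ) × ℝ × ℝ) :=
  {p | k * √p.1.2 < a + p.1.1 ∧ (a + p.1.1) * √p.2.2 ≤ p.2.1 * √p.1.2}

lemma measurableSet_confusionSet (k a : ℝ) : MeasurableSet (confusionSet k a) := by
  have h1 : MeasurableSet {p : (ℝ × ℝ) × ℝ × ℝ | k * √p.1.2 < a + p.1.1} :=
    measurableSet_lt (by fun_prop) (by fun_prop)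
  have h2 : MeasurableSet {p : (ℝ × ℝ) × ℝ × ℝ | (a + p.1.1) * √p.2.2 ≤ p.2.1 * √p.1.2} :=
    measurableSet_le (by fun_prop) (by fun_prop)
  exact h1.inter h2

lemma lintegral_excess_le {m : ℕ} (hm : 8 ≤ m) {k : ℝ} (hk : 0 < k) :
    ∫⁻ p, ENNReal.ofReal (p.1 / √p.2 - k) ∂((gaussianReal 0 1).prod (chiSq m)) ≤
      ENNReal.ofReal (3 * √m) * ENNReal.ofReal
        (16 * ((1 + k ^ 2) / (2 * k)) ^ 2 / m ^ 2 * (1 + k ^ 2) ^ (-(m : ℝ) / 2)) := by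
  rw [lintegral_prod_symm _ (by fun_prop)]
  calc ∫⁻ r, ∫⁻ x, ENNReal.ofReal (x / √r - k) ∂gaussianReal 0 1 ∂chiSq m
      ≤ ∫⁻ r, (∫⁻ t, ENNReal.ofReal (t - k) * ENNReal.ofReal (√r * exp (-(t ^ 2 / 2) * r)))
          ∂chiSq m := by
        apply lintegral_mono_ae
        filter_upwards [ae_chiSq_pos (show m ≠ 0 by omega)] with r hr
        exact lintegral_excess_gaussianReal_le hr k
    _ = ∫⁻ t, ∫⁻ r, ENNReal.ofReal (t - k) * ENNReal.ofReal (√r * exp (-(t ^ 2 / 2) * r))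
          ∂chiSq m := by
        apply lintegral_lintegral_swap
        simp only [Function.uncurry_def]
        fun_prop
    _ ≤ ∫⁻ t, ENNReal.ofReal (3 * √m) *
          (ENNReal.ofReal (t - k) * ENNReal.ofReal ((1 + t ^ 2) ^ (-(m : ℝ) / 2))) := by
        apply lintegral_mono
        intro t
        dsimp only
        rw [lintegral_const_mul _ (by fun_prop)]
        calc _ ≤ ENNReal.ofReal (t - k) *
              ENNReal.ofReal (3 * √m * (1 + t ^ 2) ^ (-(m : ℝ) / 2)) := by
                gcongr
                exact lintegral_sqrt_mul_exp_chiSq (by omega) t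
          _ = _ := by rw [ENNReal.ofReal_mul (by positivity)]; ring
    _ ≤ _ := by
        rw [lintegral_const_mul' _ _ ENNReal.ofReal_ne_top]
        gcongr
        exact lintegral_excess_rpow_le hm hk

lemma measure_confusionSet_le {m : ℕ} (hm : 8 ≤ m) {k : ℝ} (hk : 0 < k) (a : ℝ) :
    (((gaussianReal 0 1).prod (chiSq m)).prod ((gaussianReal 0 1).prod (chiSq m)))
        (confusionSet k a) ≤
      ENNReal.ofReal (144 * ((1 + k ^ 2) / (2 * k)) ^ 2 / m * (1 + k ^ 2) ^ (-(m : ℝ) / 2)) := by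
  have hS := measurableSet_confusionSet k a
  have hm' : (8 : ℝ) ≤ m := by exact_mod_cast hm
  rw [Measure.prod_apply_symm hS]
  have hsqrt : ∫⁻ r, ENNReal.ofReal (√r) ∂chiSq m ≤ ENNReal.ofReal (3 * √m) := by
    simpa using lintegral_sqrt_mul_exp_chiSq (show 2 ≤ m by omega) 0
  have hpos : ∀ᵐ p ∂((gaussianReal 0 1).prod (chiSq m)), 0 < p.2 :=
    Measure.quasiMeasurePreserving_snd.ae (ae_chiSq_pos (show m ≠ 0 by omega))
  calc ∫⁻ q, ((gaussianReal 0 1).prod (chiSq m)) ((fun p => (p, q)) ⁻¹' confusionSet k a)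
          ∂((gaussianReal 0 1).prod (chiSq m))
      ≤ ∫⁻ q, ENNReal.ofReal (3 * √m) * ENNReal.ofReal (q.1 / √q.2 - k)
          ∂((gaussianReal 0 1).prod (chiSq m)) := by
        apply lintegral_mono_ae
        filter_upwards [hpos] with q hq
        have hq' : 0 < √q.2 := sqrt_pos.2 hq
        rw [Measure.prod_apply_symm (hS.preimage (by fun_prop))]
        calc _ ≤ ∫⁻ r, ENNReal.ofReal √r * ENNReal.ofReal (q.1 / √q.2 - k) ∂chiSq m := by
              apply lintegral_mono
              intro r
              dsimp only
              calc _ ≤ gaussianReal 0 1 (Set.Icc (k * √r - a) (q.1 / √q.2 * √r - a)) := by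
                    apply measure_mono
                    rintro z ⟨h1, h2⟩
                    simp only at h1 h2
                    refine ⟨by linarith, ?_⟩
                    have : a + z ≤ q.1 * √r / √q.2 := (le_div_iff₀ hq').2 h2
                    have e : q.1 / √q.2 * √r = q.1 * √r / √q.2 := by ring
                    rw [e]
                    linarith
                _ ≤ volume (Set.Icc (k * √r - a) (q.1 / √q.2 * √r - a)) :=
                    gaussianReal_std_le_volume _
                _ = _ := by
                    rw [Real.volume_Icc, ← ENNReal.ofReal_mul (sqrt_nonneg r)]
                    congr 1
                    ring
          _ ≤ _ := by
              rw [lintegral_mul_const _ (by fun_prop)]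
              gcongr
    _ ≤ ENNReal.ofReal (3 * √m) * (ENNReal.ofReal (3 * √m) * ENNReal.ofReal
        (16 * ((1 + k ^ 2) / (2 * k)) ^ 2 / m ^ 2 * (1 + k ^ 2) ^ (-(m : ℝ) / 2))) := by
        rw [lintegral_const_mul _ (by fun_prop)]
        gcongr
        exact lintegral_excess_le hm hk
    _ = _ := by
        rw [← ENNReal.ofReal_mul (by positivity), ← ENNReal.ofReal_mul (by positivity)]
        congr 1
        have : √(m : ℝ) * √m = m := mul_self_sqrt (by positivity)
        calc _ = 144 * (√(m : ℝ) * √m) * ((1 + k ^ 2) / (2 * k)) ^ 2 / m ^ 2 *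
              (1 + k ^ 2) ^ (-(m : ℝ) / 2) := by ring
          _ = _ := by rw [this]; field_simp

/-- The point of the sphere of radius `√(nP)` in direction `g`. -/
def sphereProj (P : ℝ) {n : ℕ} (g : Fin n → ℝ) : Fin n → ℝ :=
  if ∑ i, g i ^ 2 = 0 then fun _ => √P else fun i => √(n * P) / √(∑ j, g j ^ 2) * g i

lemma measurable_sphereProj (P : ℝ) (n : ℕ) : Measurable (sphereProj P (n := n)) := by
  unfold sphereProj
  refine Measurable.ite (measurableSet_eq_fun (by fun_prop) (by fun_prop)) (by fun_prop) ?_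
  fun_prop

lemma sum_sphereProj_sq {P : ℝ} (hP : 0 < P) {n : ℕ} (g : Fin n → ℝ) :
    ∑ i, sphereProj P g i ^ 2 = n * P := by
  unfold sphereProj
  split_ifs with h
  · simp [sq_sqrt hP.le]
  · have h0 : 0 ≤ ∑ i, g i ^ 2 := Finset.sum_nonneg fun i _ => sq_nonneg _
    simp_rw [mul_pow, div_pow]
    rw [← Finset.mul_sum, sq_sqrt (by positivity), sq_sqrt h0]
    field_simp

/-- The probability that the output for input `x` lies outside the cone of slope `k` around `x`. -/
def outsideProb (k a : ℝ) {n : ℕ} (x : Fin n → ℝ) : ℝ≥0∞ :=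
  (Measure.pi fun _ : Fin n => gaussianReal 0 1)
    {z | a + ∑ i, x i / a * z i ≤ k * √(∑ i, z i ^ 2 - (∑ i, x i / a * z i) ^ 2)}

/-- The probability that the output for input `x` lies in the cone of slope `k` around `x`, but is
at least as correlated with `x'` as with `x`. -/
def confusionProb (k a : ℝ) {n : ℕ} (x x' : Fin n → ℝ) : ℝ≥0∞ :=
  (Measure.pi fun _ : Fin n => gaussianReal 0 1)
    {z | k * √(∑ i, z i ^ 2 - (∑ i, x i / a * z i) ^ 2) < a + ∑ i, x i / a * z i ∧
      ∑ i, x i * (x i + z i) ≤ ∑ i, x' i * (x i + z i)}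

lemma measurable_outsideProb (k a : ℝ) (n : ℕ) : Measurable (outsideProb k a (n := n)) := by
  have hS : MeasurableSet {p : (Fin n → ℝ) × (Fin n → ℝ) | a + ∑ i, p.1 i / a * p.2 i ≤
      k * √(∑ i, p.2 i ^ 2 - (∑ i, p.1 i / a * p.2 i) ^ 2)} :=
    measurableSet_le (by fun_prop) (by fun_prop)
  exact measurable_measure_prodMk_left hS

lemma measurableSet_confusion (k a : ℝ) (n : ℕ) :
    MeasurableSet {p : ((Fin n → ℝ) × (Fin n → ℝ)) × (Fin n → ℝ) |
      k * √(∑ i, p.2 i ^ 2 - (∑ i, p.1.1 i / a * p.2 i) ^ 2) < a + ∑ i, p.1.1 i / a * p.2 i ∧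
      ∑ i, p.1.1 i * (p.1.1 i + p.2 i) ≤ ∑ i, p.1.2 i * (p.1.1 i + p.2 i)} := by
  have h1 : MeasurableSet {p : ((Fin n → ℝ) × (Fin n → ℝ)) × (Fin n → ℝ) |
      k * √(∑ i, p.2 i ^ 2 - (∑ i, p.1.1 i / a * p.2 i) ^ 2) < a + ∑ i, p.1.1 i / a * p.2 i} :=
    measurableSet_lt (by fun_prop) (by fun_prop)
  have h2 : MeasurableSet {p : ((Fin n → ℝ) × (Fin n → ℝ)) × (Fin n → ℝ) |
      ∑ i, p.1.1 i * (p.1.1 i + p.2 i) ≤ ∑ i, p.1.2 i * (p.1.1 i + p.2 i)} :=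
    measurableSet_le (by fun_prop) (by fun_prop)
  exact h1.inter h2

lemma measurable_confusionProb (k a : ℝ) (n : ℕ) :
    Measurable fun p : (Fin n → ℝ) × (Fin n → ℝ) => confusionProb k a p.1 p.2 :=
  measurable_measure_prodMk_left (measurableSet_confusion k a n)

lemma sum_div_sq_eq_one {n : ℕ} {a : ℝ} (ha : 0 < a) {x : Fin n → ℝ}
    (hx : ∑ i, x i ^ 2 = a ^ 2) : ∑ i, (x i / a) ^ 2 = 1 := by
  simp_rw [div_pow]
  rw [← Finset.sum_div, hx, div_self (by positivity)]

lemma outsideProb_eq {m : ℕ} (k : ℝ) {a : ℝ} (ha : 0 < a) {x : Fin (m + 1) → ℝ}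
    (hx : ∑ i, x i ^ 2 = a ^ 2) :
    outsideProb k a x =
      ((gaussianReal 0 1).prod (chiSq m)) {p | a + p.1 ≤ k * √p.2} := by
  rw [← map_pi_inner_residual _ (sum_div_sq_eq_one ha hx), Measure.map_apply (by fun_prop)
    (measurableSet_le (by fun_prop) (by fun_prop))]
  rfl

lemma sq_sum_mul_le {n : ℕ} {u : Fin n → ℝ} (hu : ∑ i, u i ^ 2 = 1) (z : Fin n → ℝ) :
    (∑ i, u i * z i) ^ 2 ≤ ∑ i, z i ^ 2 := by
  have := Finset.sum_mul_sq_le_sq_mul_sq Finset.univ u z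
  rwa [hu, one_mul] at this

lemma closer_measure_le {m : ℕ} {P k a : ℝ} (hk : 0 < k) (ha : 0 < a)
    (haP : a = √((m + 1 : ℕ) * P)) {x z : Fin (m + 1) → ℝ} (hx : ∑ i, x i ^ 2 = a ^ 2)
    (hz : k * √(∑ i, z i ^ 2 - (∑ i, x i / a * z i) ^ 2) < a + ∑ i, x i / a * z i) :
    (Measure.pi fun _ : Fin (m + 1) => gaussianReal 0 1)
      {g | ∑ i, x i * (x i + z i) ≤ ∑ i, sphereProj P g i * (x i + z i)} ≤
    ((gaussianReal 0 1).prod (chiSq m)) {q | (a + ∑ i, x i / a * z i) * √q.2 ≤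
      q.1 * √(∑ i, z i ^ 2 - (∑ i, x i / a * z i) ^ 2)} := by
  set c := ∑ i, x i / a * z i with hc
  set R := ∑ i, z i ^ 2 - c ^ 2 with hR
  have hR0 : 0 ≤ R := sub_nonneg.2 (sq_sum_mul_le (sum_div_sq_eq_one ha hx) z)
  have hq : 0 < a + c := lt_of_le_of_lt (mul_nonneg hk.le (sqrt_nonneg _)) hz
  set y : Fin (m + 1) → ℝ := fun i => x i + z i with hy
  have hxz : ∑ i, x i * z i = a * c := by
    rw [hc, Finset.mul_sum]
    exact Finset.sum_congr rfl fun i _ => by field_simp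
  have hxy : ∑ i, x i * y i = a * (a + c) := by
    have : ∑ i, x i * y i = ∑ i, x i ^ 2 + ∑ i, x i * z i := by
      rw [← Finset.sum_add_distrib]
      exact Finset.sum_congr rfl fun i _ => by simp only [hy]; ring
    rw [this, hx, hxz]; ring
  have hyy : ∑ i, y i ^ 2 = (a + c) ^ 2 + R := by
    have : ∑ i, y i ^ 2 = ∑ i, x i ^ 2 + 2 * ∑ i, x i * z i + ∑ i, z i ^ 2 := by
      rw [Finset.mul_sum, ← Finset.sum_add_distrib, ← Finset.sum_add_distrib]
      exact Finset.sum_congr rfl fun i _ => by simp only [hy]; ring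
    rw [this, hx, hxz, hR]; ring
  set b := √((a + c) ^ 2 + R) with hb
  have hb2 : b ^ 2 = (a + c) ^ 2 + R := sq_sqrt (by positivity)
  have hbpos : 0 < b := sqrt_pos.2 (by positivity)
  have hyb : ∑ i, y i ^ 2 = b ^ 2 := by rw [hyy, hb2]
  have hu := sum_div_sq_eq_one hbpos hyb
  rw [← map_pi_inner_residual _ hu, Measure.map_apply (by fun_prop)
    (measurableSet_le (by fun_prop) (by fun_prop))]
  apply measure_mono
  intro g hg
  simp only [Set.mem_ofPred_eq, Set.mem_preimage] at hg ⊢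
  change ∑ i, x i * y i ≤ ∑ i, sphereProj P g i * y i at hg
  have hC := sq_sum_mul_le hu g
  set e := ∑ i, y i / b * g i with he
  set r := ∑ i, g i ^ 2 - e ^ 2 with hr
  have hr0 : 0 ≤ r := sub_nonneg.2 hC
  have hgr : ∑ i, g i ^ 2 = e ^ 2 + r := by rw [hr]; ring
  have hyg : ∑ i, y i * g i = b * e := by
    rw [he, Finset.mul_sum]
    exact Finset.sum_congr rfl fun i _ => by field_simp
  by_cases h0 : ∑ i, g i ^ 2 = 0
  · have he0 : e = 0 := by nlinarith [sq_nonneg e]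
    have hr0 : r = 0 := by rw [hr, h0, he0]; ring
    simp [he0, hr0]
  · have hs2 : √(∑ i, g i ^ 2) ^ 2 = e ^ 2 + r := by rw [sq_sqrt (by rw [hgr]; positivity), hgr]
    have hspos : 0 < √(∑ i, g i ^ 2) :=
      sqrt_pos.2 (lt_of_le_of_ne (by rw [hgr]; positivity) (Ne.symm h0))
    have h1 : ∑ i, sphereProj P g i * y i = a / √(∑ i, g i ^ 2) * (b * e) := by
      simp only [sphereProj, if_neg h0]
      rw [← haP, ← hyg, Finset.mul_sum]
      exact Finset.sum_congr rfl fun i _ => by ring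
    rw [h1, hxy] at hg
    set s := √(∑ i, g i ^ 2) with hs
    have h2 : (a + c) * s ≤ b * e := by
      have h3 : a * (a + c) ≤ a * (b * e / s) := by
        calc a * (a + c) ≤ a / s * (b * e) := hg
          _ = _ := by ring
      exact (le_div_iff₀ hspos).1 (le_of_mul_le_mul_left h3 ha)
    have he0 : 0 < e := by
      have : 0 < b * e := lt_of_lt_of_le (by positivity) h2
      exact pos_of_mul_pos_right this hbpos.le
    have h4 : ((a + c) * s) ^ 2 ≤ (b * e) ^ 2 := by gcongr
    rw [mul_pow, mul_pow, hs2, hb2] at h4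
    have h5 : (a + c) ^ 2 * r ≤ e ^ 2 * R := by nlinarith
    have h6 := sqrt_le_sqrt h5
    rwa [sqrt_mul (by positivity), sqrt_mul (by positivity), sqrt_sq hq.le, sqrt_sq he0.le] at h6

lemma lintegral_confusionProb_le {m : ℕ} {P k a : ℝ} (hk : 0 < k) (ha : 0 < a)
    (haP : a = √((m + 1 : ℕ) * P)) {x : Fin (m + 1) → ℝ} (hx : ∑ i, x i ^ 2 = a ^ 2) :
    ∫⁻ g, confusionProb k a x (sphereProj P g)
        ∂(Measure.pi fun _ : Fin (m + 1) => gaussianReal 0 1) ≤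
      (((gaussianReal 0 1).prod (chiSq m)).prod ((gaussianReal 0 1).prod (chiSq m)))
        (confusionSet k a) := by
  set γ := Measure.pi fun _ : Fin (m + 1) => gaussianReal 0 1 with hγ
  have hf : Measurable fun p : (Fin (m + 1) → ℝ) × (Fin (m + 1) → ℝ) =>
      ((x, sphereProj P p.1), p.2) :=
    (measurable_const.prodMk ((measurable_sphereProj P _).comp measurable_fst)).prodMk
      measurable_snd
  have hS := hf (measurableSet_confusion k a (m + 1))
  have hF : Measurable fun p : ℝ × ℝ => ((gaussianReal 0 1).prod (chiSq m))
      (Prod.mk p ⁻¹' confusionSet k a) :=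
    measurable_measure_prodMk_left (measurableSet_confusionSet k a)
  have h1 := Measure.prod_apply (μ := γ) (ν := γ) hS
  have h2 := Measure.prod_apply_symm (μ := γ) (ν := γ) hS
  calc ∫⁻ g, confusionProb k a x (sphereProj P g) ∂γ = (γ.prod γ) _ := h1.symm
    _ = _ := h2
    _ ≤ ∫⁻ z, ((gaussianReal 0 1).prod (chiSq m)) (Prod.mk (∑ i, x i / a * z i,
          ∑ i, z i ^ 2 - (∑ i, x i / a * z i) ^ 2) ⁻¹' confusionSet k a) ∂γ := by
        apply lintegral_mono
        intro z
        dsimp only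
        by_cases hz : k * √(∑ i, z i ^ 2 - (∑ i, x i / a * z i) ^ 2) < a + ∑ i, x i / a * z i
        · simp only [confusionSet, Set.preimage_ofPred_eq, hz, true_and]
          exact closer_measure_le hk ha haP hx hz
        · simp [hz]
    _ = _ := by
        rw [Measure.prod_apply (measurableSet_confusionSet k a),
          ← map_pi_inner_residual _ (sum_div_sq_eq_one ha hx), lintegral_map _ (by fun_prop)]
        rw [map_pi_inner_residual _ (sum_div_sq_eq_one ha hx)]
        exact hF

lemma exists_random_codebook {E : Type*} [MeasurableSpace E] (μ : Measure E)
    [IsProbabilityMeasure μ] (M : ℕ) {f : E → ℝ≥0∞} {h : E → E → ℝ≥0∞} (hf : Measurable f)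
    (hh : Measurable fun p : E × E => h p.1 p.2) {A B : ℝ≥0∞} (hA : ∫⁻ x, f x ∂μ ≤ A)
    (hB : ∀ x, ∫⁻ y, h x y ∂μ ≤ B) :
    ∃ c : Fin M → E, ∑ m, (f (c m) + ∑ m' ∈ Finset.univ.erase m, h (c m) (c m')) ≤
      M * (A + M * B) := by
  set ν := Measure.pi fun _ : Fin M => μ
  have hm1 : ∀ m : Fin M, Measurable fun c : Fin M → E => f (c m) :=
    fun m => hf.comp (measurable_pi_apply m)
  have hm2 : ∀ m m' : Fin M, Measurable fun c : Fin M → E => h (c m) (c m') :=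
    fun m m' => by
      have h2 : Measurable fun c : Fin M → E => (c m, c m') :=
        (measurable_pi_apply m).prodMk (measurable_pi_apply m')
      exact hh.comp h2
  have hm3 : ∀ m : Fin M, Measurable fun c : Fin M → E =>
      ∑ m' ∈ Finset.univ.erase m, h (c m) (c m') :=
    fun m => Finset.measurable_sum _ fun m' _ => hm2 m m'
  have hm4 : ∀ m : Fin M, Measurable fun c : Fin M → E =>
      f (c m) + ∑ m' ∈ Finset.univ.erase m, h (c m) (c m') :=
    fun m => (hm1 m).add (hm3 m)
  obtain ⟨c, hc⟩ := exists_le_lintegral (μ := ν)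
    (f := fun c => ∑ m, (f (c m) + ∑ m' ∈ Finset.univ.erase m, h (c m) (c m')))
    (Finset.measurable_sum _ fun m _ => hm4 m).aemeasurable
  refine ⟨c, hc.trans ?_⟩
  rw [lintegral_finsetSum _ fun m _ => hm4 m]
  have key : ∀ m : Fin M, ∫⁻ c, (f (c m) + ∑ m' ∈ Finset.univ.erase m, h (c m) (c m')) ∂ν ≤
      A + M * B := by
    intro m
    rw [lintegral_add_left (hm1 m)]
    refine add_le_add ?_ ?_
    · rwa [(measurePreserving_eval (fun _ : Fin M => μ) m).lintegral_comp hf]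
    · rw [lintegral_finsetSum _ fun m' _ => hm2 m m']
      calc ∑ m' ∈ Finset.univ.erase m, ∫⁻ c, h (c m) (c m') ∂ν
          ≤ ∑ m' ∈ Finset.univ.erase m, B := by
            apply Finset.sum_le_sum
            intro m' hm'
            have hne : m ≠ m' := (Finset.ne_of_mem_erase hm').symm
            have hind : IndepFun (fun c : Fin M → E => c m) (fun c => c m') ν :=
              (iIndepFun_pi (μ := fun _ : Fin M => μ) (X := fun _ x => x)
                fun _ => aemeasurable_id).indepFun hne
            have hmap := hind.map_prod_eq_prod_map_map (measurable_pi_apply m).aemeasurable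
              (measurable_pi_apply m').aemeasurable
            have e1 : ν.map (fun c => c m) = μ :=
              (measurePreserving_eval (fun _ : Fin M => μ) m).map_eq
            have e2 : ν.map (fun c => c m') = μ :=
              (measurePreserving_eval (fun _ : Fin M => μ) m').map_eq
            rw [e1, e2] at hmap
            calc ∫⁻ c, h (c m) (c m') ∂ν
                = ∫⁻ p, h p.1 p.2 ∂(ν.map fun c => (c m, c m')) :=
                  by
                  have h2 : Measurable fun c : Fin M → E => (c m, c m') :=
                    (measurable_pi_apply m).prodMk (measurable_pi_apply m')
                  exact (lintegral_map hh h2).symm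
              _ = ∫⁻ x, ∫⁻ y, h x y ∂μ ∂μ := by
                  rw [hmap, lintegral_prod _ hh.aemeasurable]
              _ ≤ ∫⁻ _, B ∂μ := lintegral_mono hB
              _ = B := by simp
        _ ≤ ∑ m' : Fin M, B := Finset.sum_le_sum_of_subset (Finset.erase_subset _ _)
        _ = M * B := by simp
  calc _ ≤ ∑ m : Fin M, (A + M * B) := Finset.sum_le_sum fun m _ => key m
    _ = _ := by simp [mul_add]

/-- The decoding region of the maximum-correlation decoder; ties count as errors. -/
def correlationRegion {n M : ℕ} (x : Fin M → Fin n → ℝ) (m : Fin M) : Set (Fin n → ℝ) :=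
  {y | ∀ m' ∈ Finset.univ.erase m, ∑ i, x m' i * y i < ∑ i, x m i * y i}

lemma measurableSet_correlationRegion {n M : ℕ} (x : Fin M → Fin n → ℝ) (m : Fin M) :
    MeasurableSet (correlationRegion x m) := by
  have h : correlationRegion x m =
      ⋂ m' ∈ Finset.univ.erase m, {y | ∑ i, x m' i * y i < ∑ i, x m i * y i} := by
    ext y; simp [correlationRegion]
  rw [h]
  exact Finset.measurableSet_biInter _ fun m' _ =>
    measurableSet_lt (by fun_prop) (by fun_prop)

lemma disjoint_correlationRegion {n M : ℕ} (x : Fin M → Fin n → ℝ) {m m' : Fin M} (h : m ≠ m') :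
    Disjoint (correlationRegion x m) (correlationRegion x m') := by
  rw [Set.disjoint_left]
  intro y hy hy'
  exact lt_asymm (hy m' (by simp [h.symm])) (hy' m (by simp [h]))

lemma Wn_compl_correlationRegion_le (k a : ℝ) {n M : ℕ} (x : Fin M → Fin n → ℝ) (m : Fin M) :
    Wn n (x m) (correlationRegion x m)ᶜ ≤
      outsideProb k a (x m) + ∑ m' ∈ Finset.univ.erase m, confusionProb k a (x m) (x m') := by
  unfold Wn outsideProb confusionProb
  refine le_trans (measure_mono ?_) ((measure_union_le _ _).trans
    (add_le_add le_rfl (measure_biUnion_finset_le _ _)))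
  intro z hz
  by_cases hg : a + ∑ i, x m i / a * z i ≤ k * √(∑ i, z i ^ 2 - (∑ i, x m i / a * z i) ^ 2)
  · exact Or.inl hg
  · right
    have hz' : ¬ ∀ m' ∈ Finset.univ.erase m,
        ∑ i, x m' i * (x m i + z i) < ∑ i, x m i * (x m i + z i) := hz
    push Not at hz' hg
    obtain ⟨m', hm', hle⟩ := hz'
    exact Set.mem_biUnion (Finset.mem_coe.2 hm') ⟨hg, hle⟩

lemma measurable_comp_pair {E F : Type*} [MeasurableSpace E] [MeasurableSpace F]
    {h : F → F → ℝ≥0∞} (hh : Measurable fun p : F × F => h p.1 p.2) {φ : E → F}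
    (hφ : Measurable φ) : Measurable fun p : E × E => h (φ p.1) (φ p.2) := by
  have hpair : Measurable fun p : E × E => (φ p.1, φ p.2) :=
    (hφ.comp measurable_fst).prodMk (hφ.comp measurable_snd)
  exact hh.comp hpair

lemma exists_sphere_codebook {m : ℕ} (M : ℕ) {P k a : ℝ} (hP : 0 < P) (hk : 0 < k) (ha : 0 < a)
    (haP : a = √((m + 1 : ℕ) * P)) {B : ℝ≥0∞}
    (hB : (((gaussianReal 0 1).prod (chiSq m)).prod ((gaussianReal 0 1).prod (chiSq m)))
        (confusionSet k a) ≤ B) :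
    ∃ x : Fin M → Fin (m + 1) → ℝ, (∀ j, ∑ i, x j i ^ 2 = (m + 1 : ℕ) * P) ∧
      ∑ j, Wn (m + 1) (x j) (correlationRegion x j)ᶜ ≤
        M * (((gaussianReal 0 1).prod (chiSq m)) {p | a + p.1 ≤ k * √p.2} + M * B) := by
  have hpow : ∀ g : Fin (m + 1) → ℝ, ∑ i, sphereProj P g i ^ 2 = a ^ 2 := fun g => by
    rw [haP, sq_sqrt (by positivity)]; exact sum_sphereProj_sq hP g
  have hproj := measurable_sphereProj P (m + 1)
  have hf : Measurable fun g : Fin (m + 1) → ℝ => outsideProb k a (sphereProj P g) :=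
    (measurable_outsideProb k a _).comp hproj
  have hh := measurable_comp_pair (h := confusionProb k a (n := m + 1))
    (measurable_confusionProb k a (m + 1)) hproj
  have hA : ∫⁻ g, outsideProb k a (sphereProj P g)
      ∂(Measure.pi fun _ : Fin (m + 1) => gaussianReal 0 1) ≤
      ((gaussianReal 0 1).prod (chiSq m)) {p | a + p.1 ≤ k * √p.2} := by
    rw [lintegral_congr fun g => outsideProb_eq k ha (hpow g)]
    simp
  obtain ⟨c, hc⟩ := exists_random_codebook
    (Measure.pi fun _ : Fin (m + 1) => gaussianReal 0 1) M
    (h := fun g g' => confusionProb k a (sphereProj P g) (sphereProj P g')) hf hh hA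
    fun g => (lintegral_confusionProb_le hk ha haP (hpow g)).trans hB
  exact ⟨fun j => sphereProj P (c j), fun j => sum_sphereProj_sq hP _,
    (Finset.sum_le_sum fun j (_ : j ∈ Finset.univ) =>
      Wn_compl_correlationRegion_le k a (fun j => sphereProj P (c j)) j).trans hc⟩

lemma exists_equal_power_code {m M : ℕ} (hm : 8 ≤ m) (hM : M ≠ 0) {P k : ℝ} (hP : 0 < P)
    (hk : 0 < k) :
    ∃ (x : Fin M → Fin (m + 1) → ℝ) (D : Fin M → Set (Fin (m + 1) → ℝ)),
      (∀ j, ∑ i, x j i ^ 2 = (m + 1 : ℕ) * P) ∧ (∀ j, MeasurableSet (D j)) ∧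
      (∀ j j', j ≠ j' → Disjoint (D j) (D j')) ∧
      (1 / M : ℝ) * ∑ j, (Wn (m + 1) (x j) (D j)ᶜ).toReal ≤
        (((gaussianReal 0 1).prod (chiSq m))
          {p | √((m + 1 : ℕ) * P) + p.1 ≤ k * √p.2}).toReal +
        M * (144 * ((1 + k ^ 2) / (2 * k)) ^ 2 / m * (1 + k ^ 2) ^ (-(m : ℝ) / 2)) := by
  have ha0 : 0 < √((m + 1 : ℕ) * P) := sqrt_pos.2 (by positivity)
  obtain ⟨x, hx, hc⟩ := exists_sphere_codebook M hP hk ha0 rfl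
    (measure_confusionSet_le hm hk (√((m + 1 : ℕ) * P)))
  refine ⟨x, correlationRegion x, hx, measurableSet_correlationRegion x,
    fun j j' h => disjoint_correlationRegion x h, ?_⟩
  have hB0 : 0 ≤ 144 * ((1 + k ^ 2) / (2 * k)) ^ 2 / m * (1 + k ^ 2) ^ (-(m : ℝ) / 2) := by
    positivity
  generalize 144 * ((1 + k ^ 2) / (2 * k)) ^ 2 / m * (1 + k ^ 2) ^ (-(m : ℝ) / 2) = B at hc hB0 ⊢
  have hA := measure_ne_top ((gaussianReal 0 1).prod (chiSq m))
    {p | √((m + 1 : ℕ) * P) + p.1 ≤ k * √p.2}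
  generalize ((gaussianReal 0 1).prod (chiSq m))
    {p | √((m + 1 : ℕ) * P) + p.1 ≤ k * √p.2} = A at hc hA ⊢
  have hfin : ∀ j, Wn (m + 1) (x j) (correlationRegion x j)ᶜ ≠ ⊤ := fun j => measure_ne_top _ _
  have hMB : M * ENNReal.ofReal B ≠ ⊤ :=
    ENNReal.mul_ne_top (ENNReal.natCast_ne_top M) ENNReal.ofReal_ne_top
  have h2 := ENNReal.toReal_mono
    (ENNReal.mul_ne_top (ENNReal.natCast_ne_top M) (ENNReal.add_ne_top.2 ⟨hA, hMB⟩)) hc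
  rw [ENNReal.toReal_mul, ENNReal.toReal_add hA hMB, ENNReal.toReal_mul,
    ENNReal.toReal_ofReal hB0, ENNReal.toReal_natCast] at h2
  have hM' : (0 : ℝ) < M := by positivity
  rw [← ENNReal.toReal_sum fun j _ => hfin j, one_div, inv_mul_le_iff₀ hM']
  exact h2

lemma gaussianPDFReal_std (x : ℝ) :
    gaussianPDFReal 0 1 x = (√(2 * π))⁻¹ * exp (-x ^ 2 / 2) := by
  simp [gaussianPDFReal]

lemma Phi_eq_integral (a : ℝ) : Phi a = ∫ u in Set.Iic a, gaussianPDFReal 0 1 u := by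
  simp only [Phi, gaussianPDFReal_std]

lemma gaussianReal_Iic (a : ℝ) : gaussianReal 0 1 (Set.Iic a) = ENNReal.ofReal (Phi a) := by
  rw [gaussianReal_apply_eq_integral _ one_ne_zero, Phi_eq_integral]

lemma Phi_nonneg (a : ℝ) : 0 ≤ Phi a := by
  rw [Phi_eq_integral]
  exact integral_nonneg fun x => gaussianPDFReal_nonneg 0 1 x

lemma Phi_eq_cdf : Phi = cdf (gaussianReal 0 1) := by
  funext a
  rw [cdf_eq_real, measureReal_def, gaussianReal_Iic, ENNReal.toReal_ofReal (Phi_nonneg a)]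

lemma Phi_le_one (a : ℝ) : Phi a ≤ 1 := by
  rw [Phi_eq_cdf]
  exact cdf_le_one _ _

lemma monotone_Phi : Monotone Phi := by
  rw [Phi_eq_cdf]
  exact monotone_cdf _

lemma measurable_Phi : Measurable Phi := monotone_Phi.measurable

lemma hasDerivAt_Phi (x : ℝ) : HasDerivAt Phi (gaussianPDFReal 0 1 x) x := by
  have hintegrable := integrable_gaussianPDFReal 0 1
  have hcont : Continuous (gaussianPDFReal 0 1) := by
    unfold gaussianPDFReal; fun_prop
  have h : Phi = fun u => Phi 0 + ∫ y in (0 : ℝ)..u, gaussianPDFReal 0 1 y := by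
    funext u
    rw [← intervalIntegral.integral_Iic_sub_Iic hintegrable.integrableOn hintegrable.integrableOn,
      ← Phi_eq_integral, ← Phi_eq_integral]
    ring
  rw [h]
  exact (intervalIntegral.integral_hasDerivAt_right (hintegrable.intervalIntegrable)
    (hcont.stronglyMeasurableAtFilter _ _) hcont.continuousAt).const_add _

lemma abs_hasDerivAt_bound_succ {g g' : ℝ → ℝ} (hg : ∀ x, HasDerivAt g (g' x) x) (h0 : g 0 = 0)
    {C : ℝ} (hC : 0 ≤ C) {j : ℕ} (hb : ∀ x, |g' x| ≤ C * |x| ^ j) (x : ℝ) :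
    |g x| ≤ C * |x| ^ (j + 1) := by
  have h := (convex_segment (0 : ℝ) x).norm_image_sub_le_of_norm_hasDerivWithin_le (f := g)
    (f' := g') (C := C * |x| ^ j) (fun y _ => (hg y).hasDerivWithinAt) (fun y hy => ?_)
    (left_mem_segment ℝ 0 x) (right_mem_segment ℝ 0 x)
  · simp only [h0, sub_zero, norm_eq_abs] at h
    rw [pow_succ, ← mul_assoc]
    exact h
  · have hy' : |y| ≤ |x| := by
      have := norm_sub_le_of_mem_segment hy
      simpa using this
    rw [norm_eq_abs]
    exact (hb y).trans (by gcongr)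

lemma hasDerivAt_gaussianPDFReal_std (x : ℝ) :
    HasDerivAt (gaussianPDFReal 0 1) (-x * gaussianPDFReal 0 1 x) x := by
  have h : gaussianPDFReal 0 1 = fun x => (√(2 * π))⁻¹ * exp (-x ^ 2 / 2) :=
    funext gaussianPDFReal_std
  rw [h]
  have h1 : HasDerivAt (fun x : ℝ => -x ^ 2 / 2) (-x) x := by
    exact (((hasDerivAt_pow 2 x).neg).div_const 2).congr_deriv (by push_cast; ring)
  exact ((h1.exp).const_mul (√(2 * π))⁻¹).congr_deriv (by ring)

lemma abs_sq_sub_one_mul_gaussianPDFReal_le (x : ℝ) :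
    |(x ^ 2 - 1) * gaussianPDFReal 0 1 x| ≤ 2 := by
  have h1 : (√(2 * π))⁻¹ ≤ 1 :=
    inv_le_one_of_one_le₀ (one_le_sqrt.2 (by nlinarith [pi_gt_three]))
  have h0 : 0 ≤ (√(2 * π))⁻¹ := by positivity
  have h2 : (1 + x ^ 2 / 2) * exp (-x ^ 2 / 2) ≤ 1 := by
    have := add_one_le_exp (x ^ 2 / 2)
    calc (1 + x ^ 2 / 2) * exp (-x ^ 2 / 2) ≤ exp (x ^ 2 / 2) * exp (-x ^ 2 / 2) := by
          gcongr; linarith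
      _ = 1 := by rw [← exp_add]; simp [neg_div]
  have h3 : |x ^ 2 - 1| ≤ 2 * (1 + x ^ 2 / 2) := by
    rw [abs_le]; constructor <;> nlinarith [sq_nonneg x]
  rw [abs_mul, abs_of_nonneg (gaussianPDFReal_nonneg 0 1 x), gaussianPDFReal_std]
  have h4 := exp_pos (-x ^ 2 / 2)
  calc |x ^ 2 - 1| * ((√(2 * π))⁻¹ * exp (-x ^ 2 / 2))
      ≤ 2 * (1 + x ^ 2 / 2) * (1 * exp (-x ^ 2 / 2)) := by gcongr
    _ ≤ 2 := by linarith

/-- Third-order Taylor estimate for the Gaussian distribution function. -/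
lemma abs_Phi_taylor_le (y h : ℝ) :
    |Phi (y + h) - (Phi y + h * gaussianPDFReal 0 1 y +
      h ^ 2 * (-y * gaussianPDFReal 0 1 y / 2))| ≤ 2 * |h| ^ 3 := by
  set p := gaussianPDFReal 0 1 y
  have hd1 : ∀ x, HasDerivAt (fun x => gaussianPDFReal 0 1 (y + x))
      (-(y + x) * gaussianPDFReal 0 1 (y + x)) x := fun x =>
    (hasDerivAt_gaussianPDFReal_std (y + x)).comp_const_add y x
  have hd2 : ∀ x, HasDerivAt
      (fun x => -(y + x) * gaussianPDFReal 0 1 (y + x) - -y * p)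
      (((y + x) ^ 2 - 1) * gaussianPDFReal 0 1 (y + x)) x := fun x => by
    have h1 : HasDerivAt (fun x => -(y + x)) (-1) x :=
      ((hasDerivAt_id x).const_add y).neg
    exact ((h1.mul (hd1 x)).sub_const (-y * p)).congr_deriv (by ring)
  have b1 : ∀ x, |-(y + x) * gaussianPDFReal 0 1 (y + x) - -y * p| ≤ 2 * |x| ^ 1 :=
    abs_hasDerivAt_bound_succ hd2 (by simp [p]) zero_le_two
      (by simpa using fun x => abs_sq_sub_one_mul_gaussianPDFReal_le (y + x))
  have b2 : ∀ x, |gaussianPDFReal 0 1 (y + x) - (p + x * (-y * p))| ≤ 2 * |x| ^ 2 :=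
    abs_hasDerivAt_bound_succ (fun x =>
      ((hd1 x).sub (((hasDerivAt_id x).mul_const (-y * p)).const_add p)).congr_deriv (by ring))
      (by simp [p]) zero_le_two b1
  exact abs_hasDerivAt_bound_succ
    (g := fun h => Phi (y + h) - (Phi y + h * p + h ^ 2 * (-y * p / 2))) (fun x => by
      have h3 := ((hasDerivAt_pow 2 x).mul_const (-y * p / 2))
      have h4 := ((hasDerivAt_id x).mul_const p).const_add (Phi y)
      have h5 := (hasDerivAt_Phi (y + x)).comp_const_add y x
      exact (h5.sub (h4.add h3)).congr_deriv (by push_cast; ring)) (by simp) zero_le_two b2 h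

lemma integrable_pow_gaussianReal_std (j : ℕ) :
    Integrable (fun z : ℝ => z ^ j) (gaussianReal 0 1) := by
  rcases eq_or_ne j 0 with rfl | hj
  · simp
  · have h := (memLp_id_gaussianReal (μ := 0) (v := 1) (j : NNReal))
    have h2 := MemLp.integrable_norm_pow (p := j) (by simpa using h) hj
    refine (integrable_norm_iff (by fun_prop)).1 ?_
    simpa using h2

lemma integral_sq_gaussianReal_std : ∫ z : ℝ, z ^ 2 ∂gaussianReal 0 1 = 1 := by
  have h := variance_fun_id_gaussianReal (μ := 0) (v := 1)
  rw [variance_eq_integral (by fun_prop)] at h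
  simpa using h

lemma integral_pow_four_gaussianReal_std : ∫ z : ℝ, z ^ 4 ∂gaussianReal 0 1 = 3 := by
  rw [integral_gaussianReal_eq_integral_smul one_ne_zero]
  have e1 : ∀ z : ℝ, gaussianPDFReal 0 1 z • z ^ 4 =
      (√(2 * π))⁻¹ * (|z| ^ 4 * exp (-(1 / 2) * |z| ^ 2)) := fun z => by
    rw [gaussianPDFReal_std, smul_eq_mul, sq_abs, show |z| ^ 4 = z ^ 4 from by
      rw [show 4 = 2 * 2 from rfl, pow_mul, pow_mul, sq_abs],
      show -(1 / 2) * z ^ 2 = -z ^ 2 / 2 by ring]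
    ring
  simp_rw [e1]
  rw [integral_const_mul, integral_comp_abs (f := fun z => z ^ 4 * exp (-(1 / 2) * z ^ 2))]
  have h := integral_rpow_mul_exp_neg_mul_rpow (p := 2) (q := 4) (b := 1 / 2) (by norm_num)
    (by norm_num) (by norm_num)
  have hG : Gamma ((4 + 1) / 2) = 3 / 4 * √π := by
    rw [show ((4 + 1) / 2 : ℝ) = (1 / 2 + 1) + 1 by norm_num, Gamma_add_one (by norm_num),
      Gamma_add_one (by norm_num), Gamma_one_half_eq]
    ring
  have hp : (1 / 2 : ℝ) ^ (-(4 + 1) / 2 : ℝ) = 4 * √2 := by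
    rw [one_div, inv_rpow zero_le_two, ← rpow_neg zero_le_two,
      show -(-(4 + 1) / 2 : ℝ) = 2 + 1 / 2 by norm_num, rpow_add two_pos, sqrt_eq_rpow]
    norm_num
  rw [hG, hp] at h
  have h' : ∫ x in Set.Ioi (0 : ℝ), x ^ 4 * exp (-(1 / 2) * x ^ 2) =
      4 * √2 * (1 / 2) * (3 / 4 * √π) := by
    rw [← h]
    refine setIntegral_congr_fun measurableSet_Ioi fun x _ => ?_
    rw [← rpow_natCast x 4, ← rpow_natCast x 2]
    norm_num
  rw [h', sqrt_mul zero_le_two]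
  have : √2 ≠ 0 := by positivity
  have : √π ≠ 0 := by positivity
  field_simp

lemma gaussianReal_map_sqrt_mul {s : ℝ} (hs : 0 ≤ s) :
    (gaussianReal 0 1).map (√s * ·) = gaussianReal 0 s.toNNReal := by
  rw [gaussianReal_map_const_mul]
  congr 1
  · simp
  · ext; simp [sq_sqrt hs, hs]

lemma gaussianReal_Iic_of_pos {s : ℝ} (hs : 0 < s) (t : ℝ) :
    gaussianReal 0 s.toNNReal (Set.Iic t) = ENNReal.ofReal (Phi (t / √s)) := by
  rw [← gaussianReal_map_sqrt_mul hs.le, Measure.map_apply (by fun_prop) measurableSet_Iic,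
    ← gaussianReal_Iic]
  congr 1
  ext x
  simp [le_div_iff₀ (sqrt_pos.2 hs), mul_comm]

lemma integrable_Phi_comp {α : Type*} [MeasurableSpace α] (μ : Measure α) [IsFiniteMeasure μ]
    {f : α → ℝ} (hf : Measurable f) : Integrable (fun x => Phi (f x)) μ :=
  Integrable.of_bound (measurable_Phi.comp hf).aestronglyMeasurable 1
    (ae_of_all _ fun x => by
      rw [norm_eq_abs, abs_of_nonneg (Phi_nonneg _)]; exact Phi_le_one _)

lemma integral_Phi_comp_eq_toReal {α : Type*} [MeasurableSpace α] (μ : Measure α)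
    [IsFiniteMeasure μ] {f : α → ℝ} (hf : Measurable f) :
    ∫ x, Phi (f x) ∂μ = (∫⁻ x, ENNReal.ofReal (Phi (f x)) ∂μ).toReal :=
  integral_eq_lintegral_of_nonneg_ae (ae_of_all _ fun _ => Phi_nonneg _)
    (measurable_Phi.comp hf).aestronglyMeasurable

lemma integral_Phi_add_mul {s b : ℝ} (hs : 0 < s) (t : ℝ) :
    ∫ g, Phi ((t + b * g) / √s) ∂gaussianReal 0 1 = Phi (t / √(s + b ^ 2)) := by
  have hconv := gaussianReal_conv_gaussianReal (m₁ := 0) (m₂ := 0) (v₁ := s.toNNReal)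
    (v₂ := (b ^ 2).toNNReal)
  have hb : gaussianReal 0 (b ^ 2).toNNReal = (gaussianReal 0 1).map (-b * ·) := by
    rw [gaussianReal_map_const_mul]
    congr 1
    · simp
    · ext; simp [sq_nonneg]
  have h := congrArg (fun μ : Measure ℝ => μ (Set.Iic t)) hconv
  simp only [add_zero] at h
  rw [← Real.toNNReal_add hs.le (sq_nonneg b), gaussianReal_Iic_of_pos (by positivity),
    Measure.conv, Measure.map_apply (by fun_prop) measurableSet_Iic,
    Measure.prod_apply_symm (measurableSet_Iic.preimage (by fun_prop)), hb,
    lintegral_map (measurable_measure_prodMk_right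
      (measurableSet_Iic.preimage (by fun_prop))) (by fun_prop)] at h
  rw [integral_Phi_comp_eq_toReal _ (by fun_prop), ← ENNReal.toReal_ofReal (Phi_nonneg _), ← h]
  congr 1
  refine lintegral_congr fun g => ?_
  rw [← gaussianReal_Iic_of_pos hs]
  congr 1
  ext x
  simp

/-- The centred, half-scaled square of a standard Gaussian, which has the same first two moments as
a centred Gaussian of variance `1/2`. -/
def halfSq (z : ℝ) : ℝ := (z ^ 2 - 1) / 2

lemma integrable_halfSq : Integrable halfSq (gaussianReal 0 1) :=
  ((integrable_pow_gaussianReal_std 2).sub (integrable_const 1)).div_const 2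

lemma integral_halfSq : ∫ z, halfSq z ∂gaussianReal 0 1 = 0 := by
  unfold halfSq
  rw [integral_div, integral_sub (integrable_pow_gaussianReal_std 2) (integrable_const 1),
    integral_sq_gaussianReal_std]
  simp

lemma halfSq_sq (z : ℝ) : halfSq z ^ 2 = (z ^ 4 - 2 * z ^ 2 + 1) / 4 := by
  unfold halfSq; ring

lemma integrable_halfSq_sq : Integrable (fun z => halfSq z ^ 2) (gaussianReal 0 1) := by
  simp_rw [halfSq_sq]
  exact (((integrable_pow_gaussianReal_std 4).sub
    ((integrable_pow_gaussianReal_std 2).const_mul 2)).add (integrable_const 1)).div_const 4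

lemma integral_halfSq_sq : ∫ z, halfSq z ^ 2 ∂gaussianReal 0 1 = 1 / 2 := by
  simp_rw [halfSq_sq]
  have h4 := integrable_pow_gaussianReal_std 4
  have h2 := (integrable_pow_gaussianReal_std 2).const_mul 2
  have h42 : Integrable (fun z : ℝ => z ^ 4 - 2 * z ^ 2) (gaussianReal 0 1) := h4.sub h2
  rw [integral_div, integral_add h42 (integrable_const 1), integral_sub h4 h2,
    integral_const_mul, integral_sq_gaussianReal_std, integral_pow_four_gaussianReal_std]
  norm_num

lemma integrable_abs_halfSq_cube : Integrable (fun z => |halfSq z| ^ 3) (gaussianReal 0 1) := by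
  have h : Integrable (fun z => halfSq z ^ 3) (gaussianReal 0 1) := by
    have e : ∀ z, halfSq z ^ 3 = (z ^ 6 - 3 * z ^ 4 + 3 * z ^ 2 - 1) / 8 := fun z => by
      unfold halfSq; ring
    simp_rw [e]
    exact ((((integrable_pow_gaussianReal_std 6).sub
      ((integrable_pow_gaussianReal_std 4).const_mul 3)).add
      ((integrable_pow_gaussianReal_std 2).const_mul 3)).sub (integrable_const 1)).div_const 8
  simpa [abs_pow] using h.abs

/-- The constant in the Lindeberg replacement step for half-scaled squares. -/
def replacementConst : ℝ :=
  2 * ∫ z, |halfSq z| ^ 3 ∂gaussianReal 0 1 + 2 * ∫ z : ℝ, |z| ^ 3 ∂gaussianReal 0 1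

lemma replacementConst_nonneg : 0 ≤ replacementConst := by
  unfold replacementConst; positivity

/-- Taylor expansion of the mean of `Phi` under a centred random perturbation. -/
lemma abs_integral_Phi_add_sub_le {ν : Measure ℝ} [IsProbabilityMeasure ν] {X : ℝ → ℝ}
    (hX : Measurable X) (h1 : Integrable X ν) (h2 : Integrable (fun z => X z ^ 2) ν)
    (h3 : Integrable (fun z => |X z| ^ 3) ν) (hm : ∫ z, X z ∂ν = 0) (y : ℝ) :
    |∫ z, Phi (y + X z) ∂ν -
      (Phi y + (∫ z, X z ^ 2 ∂ν) * (-y * gaussianPDFReal 0 1 y / 2))| ≤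
      2 * ∫ z, |X z| ^ 3 ∂ν := by
  have hi := integrable_Phi_comp ν (hX.const_add y)
  have e : ∫ z, (Phi (y + X z) - (Phi y + X z * gaussianPDFReal 0 1 y +
      X z ^ 2 * (-y * gaussianPDFReal 0 1 y / 2))) ∂ν = ∫ z, Phi (y + X z) ∂ν -
      (Phi y + (∫ z, X z ^ 2 ∂ν) * (-y * gaussianPDFReal 0 1 y / 2)) := by
    have i1 : Integrable (fun z => Phi y + X z * gaussianPDFReal 0 1 y) ν :=
      (integrable_const _).add (h1.mul_const _)
    have i2 : Integrable (fun z => Phi y + X z * gaussianPDFReal 0 1 y +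
        X z ^ 2 * (-y * gaussianPDFReal 0 1 y / 2)) ν := i1.add (h2.mul_const _)
    rw [integral_sub hi i2, integral_add i1 (h2.mul_const _),
      integral_add (integrable_const _) (h1.mul_const _), integral_mul_const,
      integral_mul_const, hm]
    simp
  rw [← e, ← integral_const_mul]
  exact (abs_integral_le_integral_abs).trans (integral_mono_of_nonneg
    (ae_of_all _ fun _ => abs_nonneg _) (h3.const_mul 2)
    (ae_of_all _ fun z => abs_Phi_taylor_le y (X z)))

lemma integral_Phi_add_halfSq_le {s u : ℝ} (hs : 1 ≤ s) (hu : 0 ≤ u) (t : ℝ) :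
    ∫ z, Phi ((t + u * halfSq z) / √s) ∂gaussianReal 0 1 ≤
      Phi (t / √(s + u ^ 2 / 2)) + replacementConst * u ^ 3 := by
  set v := u / √s with hv
  have hs1 : 1 ≤ √s := one_le_sqrt.2 hs
  have hv0 : 0 ≤ v := by positivity
  have hvu : v ≤ u := div_le_self hu hs1
  set w := (√2)⁻¹ with hw
  have hw0 : 0 ≤ w := by positivity
  have hw1 : w ≤ 1 := inv_le_one_of_one_le₀ (one_le_sqrt.2 one_le_two)
  have hw2 : w ^ 2 = 1 / 2 := by rw [hw, inv_pow, sq_sqrt zero_le_two]; norm_num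
  have a1 := abs_integral_Phi_add_sub_le (ν := gaussianReal 0 1) (X := fun z => v * halfSq z)
    (by unfold halfSq; fun_prop) (integrable_halfSq.const_mul v)
    (by simpa [mul_pow] using integrable_halfSq_sq.const_mul (v ^ 2))
    (by simpa [mul_pow, abs_mul] using integrable_abs_halfSq_cube.const_mul (|v| ^ 3))
    (by rw [integral_const_mul, integral_halfSq, mul_zero]) (t / √s)
  have hg3 : Integrable (fun z : ℝ => |z| ^ 3) (gaussianReal 0 1) := by
    simpa [abs_pow] using (integrable_pow_gaussianReal_std 3).abs
  have a2 := abs_integral_Phi_add_sub_le (ν := gaussianReal 0 1) (X := fun z => v * w * z)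
    (by fun_prop) (by simpa using (integrable_pow_gaussianReal_std 1).const_mul (v * w))
    (by simpa [mul_pow] using (integrable_pow_gaussianReal_std 2).const_mul (v ^ 2 * w ^ 2))
    (by simpa [mul_pow, abs_mul] using hg3.const_mul (|v| ^ 3 * |w| ^ 3))
    (by rw [integral_const_mul, integral_id_gaussianReal, mul_zero]) (t / √s)
  simp only [mul_pow, abs_mul, integral_const_mul, integral_halfSq_sq, integral_sq_gaussianReal_std,
    abs_of_nonneg hv0, abs_of_nonneg hw0, hw2, mul_one] at a1 a2
  have e1 : ∀ z, t / √s + v * halfSq z = (t + u * halfSq z) / √s := fun z => by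
    rw [hv]; ring
  have e2 : ∀ z, t / √s + v * w * z = (t + u * w * z) / √s := fun z => by
    rw [hv]; ring
  simp_rw [e1] at a1
  simp_rw [e2, integral_Phi_add_mul (zero_lt_one.trans_le hs), mul_pow, hw2] at a2
  have b1 := (abs_le.1 a1).2
  have b2 := (abs_le.1 a2).1
  have i1 : 0 ≤ ∫ z, |halfSq z| ^ 3 ∂gaussianReal 0 1 := by positivity
  have i2 : 0 ≤ ∫ z : ℝ, |z| ^ 3 ∂gaussianReal 0 1 := by positivity
  have hv3 : v ^ 3 ≤ u ^ 3 := by gcongr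
  have hw3 : w ^ 3 ≤ 1 := pow_le_one₀ hw0 hw1
  have hvw : v ^ 3 * w ^ 3 ≤ u ^ 3 := by
    calc v ^ 3 * w ^ 3 ≤ u ^ 3 * 1 := by gcongr
      _ = u ^ 3 := mul_one _
  have c1 := mul_le_mul_of_nonneg_right hv3 i1
  have c2 := mul_le_mul_of_nonneg_right hvw i2
  unfold replacementConst
  rw [show u ^ 2 / 2 = u ^ 2 * (1 / 2) by ring]
  linarith

/-- Berry–Esseen type bound for the chi-square distribution, smoothed by a Gaussian. -/
lemma integral_Phi_chiSq_le {u : ℝ} (hu : 0 ≤ u) (j : ℕ) (t : ℝ) :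
    ∫ r, Phi (t + u * (r - j) / 2) ∂chiSq j ≤
      Phi (t / √(1 + j * (u ^ 2 / 2))) + j * (replacementConst * u ^ 3) := by
  induction j generalizing t with
  | zero => simp [chiSq]
  | succ j ih =>
    have hm : Measurable fun p : ℝ × ℝ =>
        t + u * ((p.1 ^ 2 + p.2) - ((j + 1 : ℕ) : ℝ)) / 2 := by fun_prop
    have hm' : Measurable fun r : ℝ => t + u * (r - ((j + 1 : ℕ) : ℝ)) / 2 := by fun_prop
    have hq : Measurable fun p : ℝ × ℝ => p.1 ^ 2 + p.2 := by fun_prop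
    rw [chiSq_succ, integral_map hq.aemeasurable
      (f := fun r => Phi (t + u * (r - ((j + 1 : ℕ) : ℝ)) / 2))
      (measurable_Phi.comp hm').aestronglyMeasurable,
      integral_prod _ (integrable_Phi_comp _ hm)]
    have h1 : ∀ z : ℝ, ∫ r, Phi (t + u * ((z ^ 2 + r) - ((j + 1 : ℕ) : ℝ)) / 2) ∂chiSq j ≤
        Phi ((t + u * halfSq z) / √(1 + j * (u ^ 2 / 2))) + j * (replacementConst * u ^ 3) :=
      fun z => by
        refine le_trans (le_of_eq ?_) (ih (t + u * halfSq z))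
        refine integral_congr_ae (ae_of_all _ fun r => ?_)
        simp only [halfSq]
        congr 1
        push_cast
        ring
    have hi : Integrable (fun z => Phi ((t + u * halfSq z) / √(1 + j * (u ^ 2 / 2))))
        (gaussianReal 0 1) :=
      integrable_Phi_comp _ (by unfold halfSq; fun_prop)
    calc _ ≤ ∫ z, (Phi ((t + u * halfSq z) / √(1 + j * (u ^ 2 / 2))) +
          j * (replacementConst * u ^ 3)) ∂gaussianReal 0 1 :=
        integral_mono_of_nonneg (ae_of_all _ fun z => integral_nonneg fun r => Phi_nonneg _)
          (hi.add (integrable_const _)) (ae_of_all _ h1)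
      _ = ∫ z, Phi ((t + u * halfSq z) / √(1 + j * (u ^ 2 / 2))) ∂gaussianReal 0 1 +
          j * (replacementConst * u ^ 3) := by
        rw [integral_add hi (integrable_const _)]; simp
      _ ≤ (Phi (t / √(1 + j * (u ^ 2 / 2) + u ^ 2 / 2)) + replacementConst * u ^ 3) +
          j * (replacementConst * u ^ 3) := by
        gcongr
        exact integral_Phi_add_halfSq_le (le_add_of_nonneg_right (by positivity)) hu t
      _ = _ := by
        rw [show 1 + (j : ℝ) * (u ^ 2 / 2) + u ^ 2 / 2 = 1 + ((j + 1 : ℕ) : ℝ) * (u ^ 2 / 2) by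
          push_cast; ring]
        push_cast; ring

lemma outside_measure_le {m : ℕ} (hm : m ≠ 0) {k : ℝ} (hk : 0 ≤ k) (a : ℝ) :
    (((gaussianReal 0 1).prod (chiSq m)) {p | a + p.1 ≤ k * √p.2}).toReal ≤
      Phi ((k * √m - a) / √(1 + k ^ 2 / 2)) + replacementConst * k ^ 3 / √m := by
  have hm0 : (0 : ℝ) < m := by positivity
  have hs0 : 0 < √(m : ℝ) := sqrt_pos.2 hm0
  have hss : √(m : ℝ) ^ 2 = m := sq_sqrt hm0.le
  have e : ((gaussianReal 0 1).prod (chiSq m)) {p | a + p.1 ≤ k * √p.2} =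
      ∫⁻ r, ENNReal.ofReal (Phi (k * √r - a)) ∂chiSq m := by
    rw [Measure.prod_apply_symm (measurableSet_le (by fun_prop) (by fun_prop))]
    refine lintegral_congr fun r => ?_
    rw [← gaussianReal_Iic]
    congr 1
    ext x
    simp [le_sub_iff_add_le, add_comm]
  rw [e, ← integral_Phi_comp_eq_toReal _ (by fun_prop)]
  have h := integral_Phi_chiSq_le (u := k / √m) (by positivity) m (k * √m - a)
  have e1 : (m : ℝ) * ((k / √m) ^ 2 / 2) = k ^ 2 / 2 := by
    rw [div_pow, hss]; field_simp
  have e2 : (m : ℝ) * (replacementConst * (k / √m) ^ 3) = replacementConst * k ^ 3 / √m := by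
    nth_rewrite 1 [← hss]
    field_simp
  rw [e1, e2] at h
  refine le_trans (integral_mono_ae (integrable_Phi_comp _ (by fun_prop))
    (integrable_Phi_comp _ (by fun_prop)) ?_) h
  filter_upwards [ae_chiSq_pos hm] with r hr
  apply monotone_Phi
  have h1 : √r ≤ √m + (r - m) / (2 * √m) := by
    rw [← sub_nonneg]
    have : √m + (r - m) / (2 * √m) - √r = (√m - √r) ^ 2 / (2 * √m) := by
      field_simp
      rw [hss]
      nlinarith [sq_sqrt hr.le]
    rw [this]; positivity
  have h2 := mul_le_mul_of_nonneg_left h1 hk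
  have h3 : k / √m * (r - m) / 2 = k * ((r - m) / (2 * √m)) := by field_simp
  rw [h3]; linarith

lemma continuous_Phi : Continuous Phi :=
  continuous_iff_continuousAt.2 fun x => (hasDerivAt_Phi x).continuousAt

lemma Phi_PhiInv_le {ε : ℝ} (hε : ε ∈ Set.Ioo (0 : ℝ) 1) : Phi (PhiInv ε) ≤ ε := by
  have hbot : Filter.Tendsto Phi Filter.atBot (nhds 0) := by
    rw [Phi_eq_cdf]; exact tendsto_cdf_atBot _
  have htop : Filter.Tendsto Phi Filter.atTop (nhds 1) := by
    rw [Phi_eq_cdf]; exact tendsto_cdf_atTop _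
  have hclosed : IsClosed {a : ℝ | Phi a ≤ ε} := isClosed_le continuous_Phi continuous_const
  obtain ⟨a, ha⟩ := (hbot.eventually_le_const hε.1).exists
  obtain ⟨b, hb⟩ := (htop.eventually_const_lt hε.2).exists
  refine hclosed.csSup_mem ⟨a, ha⟩ ⟨b, fun x hx => ?_⟩
  by_contra! h
  exact absurd (hb.trans_le (monotone_Phi h.le)) (not_lt.2 hx)

lemma Phi_sub_le (p : ℝ) {t : ℝ} (h0 : 0 ≤ t) (h1 : t ≤ 1) :
    Phi (p - t) ≤ Phi p - t * gaussianPDFReal 0 1 (|p| + 1) := by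
  have h := (convex_Icc (p - t) p).mul_sub_le_image_sub_of_le_deriv (f := Phi)
    (C := gaussianPDFReal 0 1 (|p| + 1)) continuous_Phi.continuousOn
    (fun x _ => (hasDerivAt_Phi x).differentiableAt.differentiableWithinAt) (fun x hx => ?_)
    (p - t) ⟨le_rfl, by linarith⟩ p ⟨by linarith, le_rfl⟩ (by linarith)
  · linarith
  · rw [interior_Icc] at hx
    have hx' : |x| ≤ |p| + 1 := by
      rw [abs_le]
      constructor <;> linarith [hx.1, hx.2, le_abs_self p, neg_abs_le p]
    rw [(hasDerivAt_Phi x).deriv, gaussianPDFReal_std, gaussianPDFReal_std]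
    have : x ^ 2 ≤ (|p| + 1) ^ 2 := sq_le_sq' (by linarith [neg_abs_le x])
      ((le_abs_self x).trans hx')
    gcongr

lemma abs_sqrt_one_add_half_sq_sub_le (x y : ℝ) :
    |√(1 + x ^ 2 / 2) - √(1 + y ^ 2 / 2)| ≤ |x - y| := by
  set a := √(1 + x ^ 2 / 2)
  set b := √(1 + y ^ 2 / 2)
  have ha : a ^ 2 = 1 + x ^ 2 / 2 := sq_sqrt (by positivity)
  have hb : b ^ 2 = 1 + y ^ 2 / 2 := sq_sqrt (by positivity)
  have ha0 : 0 ≤ a := sqrt_nonneg _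
  have hb0 : 0 ≤ b := sqrt_nonneg _
  have hxa : |x| ≤ 2 * a := by
    refine abs_le_of_sq_le_sq ?_ (by positivity)
    nlinarith
  have hyb : |y| ≤ 2 * b := by
    refine abs_le_of_sq_le_sq ?_ (by positivity)
    nlinarith
  have hab : 0 < a + b := by
    have : 0 < a := sqrt_pos.2 (by positivity)
    linarith
  have e : (a - b) * (a + b) = (x - y) * ((x + y) / 2) := by nlinarith
  have h2 : |(x + y) / 2| ≤ a + b := by
    rw [abs_div, abs_two]
    linarith [abs_add_le x y]
  have h3 : |a - b| * (a + b) ≤ |x - y| * (a + b) := by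
    calc |a - b| * (a + b) = |(a - b) * (a + b)| := by rw [abs_mul, abs_of_pos hab]
      _ = |x - y| * |(x + y) / 2| := by rw [e, abs_mul]
      _ ≤ _ := by gcongr
  exact le_of_mul_le_mul_right h3 hab

lemma threshold_le {s p c T k δ : ℝ} (hs : 0 < s) (hc : 0 ≤ c) (hT : 0 < T) (hcT : c ≤ T)
    (hδ : δ = (p * √(1 + s ^ 2 / 2) - c / T) / T) (hk : k = s + δ) (hk0 : 0 < k)
    (hk2 : k ≤ 2 * s) {r : ℝ} (hr : r ≤ T) :
    (k * r - s * T) / √(1 + k ^ 2 / 2) ≤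
      p - (c / √(1 + 2 * s ^ 2) - |p| * (|p| * √(1 + s ^ 2 / 2) + 1)) / T := by
  set σ := √(1 + s ^ 2 / 2)
  set τ := √(1 + k ^ 2 / 2)
  have hσ : 0 ≤ σ := sqrt_nonneg _
  have hτ1 : 1 ≤ τ := one_le_sqrt.2 (by nlinarith [sq_nonneg k])
  have hτ0 : 0 < τ := by linarith
  have hτ2 : τ ≤ √(1 + 2 * s ^ 2) := sqrt_le_sqrt (by nlinarith)
  have hcT1 : c / T ≤ 1 := (div_le_one hT).2 hcT
  have hcT0 : 0 ≤ c / T := by positivity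
  have hδabs : |δ| ≤ (|p| * σ + 1) / T := by
    rw [hδ, abs_div, abs_of_pos hT]
    gcongr
    calc |p * σ - c / T| ≤ |p * σ| + |c / T| := abs_sub _ _
      _ ≤ |p| * σ + 1 := by
        rw [abs_mul, abs_of_nonneg hσ, abs_of_nonneg hcT0]; linarith
  have hτσ : |σ - τ| ≤ |δ| := by
    have := abs_sqrt_one_add_half_sq_sub_le s k
    rwa [hk, show s - (s + δ) = -δ by ring, abs_neg, ← hk] at this
  have h1 : k * r - s * T ≤ p * σ - c / T := by
    have e : p * σ - c / T = δ * T := by rw [hδ]; field_simp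
    have := mul_le_mul_of_nonneg_left hr hk0.le
    rw [e]
    have e2 : k * T = s * T + δ * T := by rw [hk]; ring
    linarith
  have h2 : p * (σ - τ) / τ ≤ |p| * (|p| * σ + 1) / T := by
    calc p * (σ - τ) / τ ≤ |p * (σ - τ)| / τ := by gcongr; exact le_abs_self _
      _ ≤ |p * (σ - τ)| := div_le_self (abs_nonneg _) hτ1
      _ = |p| * |σ - τ| := abs_mul _ _
      _ ≤ |p| * ((|p| * σ + 1) / T) := by gcongr; exact hτσ.trans hδabs
      _ = _ := by ring
  have h3 : c / √(1 + 2 * s ^ 2) / T ≤ c / T / τ := by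
    rw [div_right_comm]
    gcongr
  calc (k * r - s * T) / τ ≤ (p * σ - c / T) / τ := by gcongr
    _ = p + p * (σ - τ) / τ - c / T / τ := by field_simp; ring
    _ ≤ p + |p| * (|p| * σ + 1) / T - c / √(1 + 2 * s ^ 2) / T := by linarith
    _ = _ := by ring

lemma union_bound_le {m : ℕ} (hm : 1 ≤ m) {s k M : ℝ} (hs : 0 < s) (hk1 : s / 2 ≤ k)
    (hk2 : k ≤ 2 * s) (hM : M ≤ √((m + 1 : ℕ) : ℝ) * (1 + k ^ 2) ^ (((m + 1 : ℕ) : ℝ) / 2)) :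
    M * (144 * ((1 + k ^ 2) / (2 * k)) ^ 2 / m * (1 + k ^ 2) ^ (-(m : ℝ) / 2)) ≤
      288 * ((1 + 4 * s ^ 2) / s) ^ 2 * (1 + 4 * s ^ 2) / √((m + 1 : ℕ) : ℝ) := by
  have hk0 : 0 < k := by linarith
  have hm0 : (1 : ℝ) ≤ m := by exact_mod_cast hm
  set T := √((m + 1 : ℕ) : ℝ) with hTdef
  have hT : 0 < T := sqrt_pos.2 (by positivity)
  have hT2 : T ^ 2 = m + 1 := by rw [hTdef, sq_sqrt (by positivity)]; push_cast; rfl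
  have hq : 1 + k ^ 2 ≤ 1 + 4 * s ^ 2 := by nlinarith
  have hq1 : 1 ≤ 1 + k ^ 2 := by nlinarith
  have hpow : (1 + k ^ 2) ^ (((m + 1 : ℕ) : ℝ) / 2) * (1 + k ^ 2) ^ (-(m : ℝ) / 2) ≤
      1 + 4 * s ^ 2 := by
    rw [← rpow_add (by linarith)]
    calc (1 + k ^ 2) ^ (((m + 1 : ℕ) : ℝ) / 2 + -(m : ℝ) / 2) ≤ (1 + k ^ 2) ^ (1 : ℝ) :=
          rpow_le_rpow_of_exponent_le hq1 (by push_cast; linarith)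
      _ ≤ _ := by rwa [rpow_one]
  have hdiv : (1 + k ^ 2) / (2 * k) ≤ (1 + 4 * s ^ 2) / s := by
    gcongr; linarith
  have hTm : T / m ≤ 2 / T := by
    rw [div_le_div_iff₀ (by linarith) hT]
    nlinarith
  calc M * (144 * ((1 + k ^ 2) / (2 * k)) ^ 2 / m * (1 + k ^ 2) ^ (-(m : ℝ) / 2))
      ≤ T * (1 + k ^ 2) ^ (((m + 1 : ℕ) : ℝ) / 2) *
          (144 * ((1 + k ^ 2) / (2 * k)) ^ 2 / m * (1 + k ^ 2) ^ (-(m : ℝ) / 2)) := by gcongr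
    _ = 144 * ((1 + k ^ 2) / (2 * k)) ^ 2 * (T / m) *
          ((1 + k ^ 2) ^ (((m + 1 : ℕ) : ℝ) / 2) * (1 + k ^ 2) ^ (-(m : ℝ) / 2)) := by ring
    _ ≤ 144 * ((1 + 4 * s ^ 2) / s) ^ 2 * (2 / T) * (1 + 4 * s ^ 2) := by gcongr
    _ = _ := by ring

lemma sub_four_mul_sq_le_log_one_add {w : ℝ} (hw : -(3 / 4) ≤ w) :
    w - 4 * w ^ 2 ≤ log (1 + w) := by
  have h0 : 0 < 1 + w := by linarith
  refine le_trans ?_ (one_sub_inv_le_log_of_pos h0)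
  have e : 1 - (1 + w)⁻¹ = w - w ^ 2 * (1 + w)⁻¹ := by field_simp; ring
  have h4 : (1 + w)⁻¹ ≤ 4 := inv_le_of_inv_le₀ (by norm_num) (by linarith)
  rw [e]
  nlinarith [mul_le_mul_of_nonneg_left h4 (sq_nonneg w)]

lemma sqrt_mul_gaussV {P : ℝ} (hP : 0 < P) (n : ℝ) (hn : 0 ≤ n) :
    √(n * gaussV P) = √n * (√P * √(1 + P / 2) / (1 + P)) := by
  rw [sqrt_mul hn]
  congr 1
  rw [gaussV, ← sqrt_mul hP.le, show P * (P + 2) / (2 * (P + 1) ^ 2) =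
    P * (1 + P / 2) / (1 + P) ^ 2 by field_simp; ring, sqrt_div (by positivity),
    sqrt_sq (by positivity)]

/-- The rate of the slope-`k` cone decoder, when `k` is close to `√P`. -/
lemma log_rate_ge {P k δ D n : ℝ} (hP : 0 < P) (hk : k = √P + δ) (hδ : |δ| ≤ √P / 2)
    (hn : 0 ≤ n) (hD : n * δ ^ 2 ≤ D ^ 2) :
    n * gaussC P + n * δ * √P / (1 + P) - 18 * P * D ^ 2 ≤ n / 2 * log (1 + k ^ 2) := by
  set s := √P with hs
  have hs0 : 0 < s := sqrt_pos.2 hP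
  have hs2 : s ^ 2 = P := sq_sqrt hP.le
  obtain ⟨hδ1, hδ2⟩ := abs_le.1 hδ
  have h1P : 0 < 1 + P := by linarith
  set w := (2 * s * δ + δ ^ 2) / (1 + P) with hw
  have hkw : 1 + k ^ 2 = (1 + P) * (1 + w) := by
    rw [hw, hk, ← hs2]; field_simp; ring
  have hw1 : -(3 / 4) ≤ w := by
    rw [hw, le_div_iff₀ h1P]
    nlinarith
  have hlog : log (1 + k ^ 2) = log (1 + P) + log (1 + w) := by
    rw [hkw, log_mul h1P.ne' (by linarith)]
  have hw2 : w ^ 2 ≤ 9 * P * δ ^ 2 := by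
    have e : w ^ 2 = δ ^ 2 * (2 * s + δ) ^ 2 / (1 + P) ^ 2 := by rw [hw, div_pow]; ring
    rw [e]
    calc δ ^ 2 * (2 * s + δ) ^ 2 / (1 + P) ^ 2 ≤ δ ^ 2 * (2 * s + δ) ^ 2 :=
          div_le_self (by positivity) (by nlinarith)
      _ ≤ δ ^ 2 * (3 * s) ^ 2 := by
          gcongr <;> linarith
      _ = 9 * P * δ ^ 2 := by rw [mul_pow, hs2]; ring
  have hwl : 2 * s * δ / (1 + P) ≤ w := by
    rw [hw]; gcongr; nlinarith
  have h := sub_four_mul_sq_le_log_one_add hw1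
  rw [hlog, gaussC]
  have h5 : 2 * s * δ / (1 + P) - 36 * P * δ ^ 2 ≤ log (1 + w) := by linarith
  have h6 := mul_le_mul_of_nonneg_left h5 (by positivity : 0 ≤ n / 2)
  have h7 := mul_le_mul_of_nonneg_left hD (by positivity : 0 ≤ 18 * P)
  have e8 : n / 2 * (2 * s * δ / (1 + P)) = n * δ * s / (1 + P) := by ring
  nlinarith

lemma half_le_natFloor {x : ℝ} (hx : 1 ≤ x) : x / 2 ≤ (⌊x⌋₊ : ℝ) := by
  have h1 : (1 : ℝ) ≤ ⌊x⌋₊ := by exact_mod_cast Nat.one_le_floor_iff _ |>.2 hx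
  have h2 := (Nat.lt_floor_add_one x).le
  linarith

/-- Third-order achievability for the AWGN channel with an equal power constraint:
for all large `n` there is a code whose codewords satisfy `‖x(m)‖₂² = nP` exactly, with
pairwise disjoint measurable decoding regions, average error probability at most `ε`, and
`log M ≥ n C(P) + √(n V(P)) Φ⁻¹(ε) + (1/2) log n - c`. -/
theorem awgn_equal_power_achievability (ε P : ℝ) (hε : ε ∈ Set.Ioo (0 : ℝ) 1) (hP : 0 < P) :
    ∃ c > (0 : ℝ), ∃ N : ℕ, ∀ n : ℕ, n ≥ N → ∃ M : ℕ,
      (∃ (x : Fin M → Fin n → ℝ) (D : Fin M → Set (Fin n → ℝ)),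
        (∀ m, ∑ i, x m i ^ 2 = n * P) ∧
        (∀ m, MeasurableSet (D m)) ∧
        (∀ m m', m ≠ m' → Disjoint (D m) (D m')) ∧
        (1 / M : ℝ) * ∑ m, (Wn n (x m) (D m)ᶜ).toReal ≤ ε) ∧
      Real.log M ≥
        n * gaussC P + Real.sqrt (n * gaussV P) * PhiInv ε + (1 / 2) * Real.log n - c := by
  set p := PhiInv ε with hp
  set s := √P with hs
  have hs0 : 0 < s := sqrt_pos.2 hP
  have hs2 : s ^ 2 = P := sq_sqrt hP.le
  set σ := √(1 + s ^ 2 / 2) with hσ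
  have hσ0 : 0 ≤ σ := sqrt_nonneg _
  set φ := gaussianPDFReal 0 1 (|p| + 1)
  have hφ : 0 < φ := gaussianPDFReal_pos _ _ _ one_ne_zero
  have hR := replacementConst_nonneg
  set K := 2 * (replacementConst * (2 * s) ^ 3) +
    288 * ((1 + 4 * s ^ 2) / s) ^ 2 * (1 + 4 * s ^ 2) with hK
  have hK0 : 0 < K := by positivity
  set D := |p| * σ + 1 with hD
  have hD0 : 0 < D := by positivity
  set c₀ := K / φ with hc₀
  have hc₀0 : 0 < c₀ := by positivity
  set c := √(1 + 2 * s ^ 2) * (|p| * D + c₀) with hc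
  have hsq : 0 < √(1 + 2 * s ^ 2) := sqrt_pos.2 (by positivity)
  have hc0 : 0 < c := by positivity
  have hcdiv : c / √(1 + 2 * s ^ 2) - |p| * D = c₀ := by rw [hc]; field_simp; ring
  obtain ⟨N, hN⟩ := exists_nat_ge (max (max c c₀) (max (2 * D / s) 1) ^ 2)
  refine ⟨log 2 + s * c + 18 * P * D ^ 2, by positivity, max N 9, fun n hn => ?_⟩
  obtain ⟨m, rfl⟩ : ∃ m, n = m + 1 := ⟨n - 1, by omega⟩
  have hm : 8 ≤ m := by omega
  have hm0 : (8 : ℝ) ≤ m := by exact_mod_cast hm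
  have hNn : (N : ℝ) ≤ ((m + 1 : ℕ) : ℝ) := by exact_mod_cast (le_max_left N 9).trans hn
  set n : ℝ := ((m + 1 : ℕ) : ℝ) with hn_def
  have hnm : n = m + 1 := by rw [hn_def]; push_cast; rfl
  have hn0 : 0 < n := by linarith
  set T := √n with hT
  have hT0 : 0 < T := sqrt_pos.2 hn0
  have hT2 : T ^ 2 = n := sq_sqrt hn0.le
  have hTmax : max (max c c₀) (max (2 * D / s) 1) ≤ T := le_sqrt_of_sq_le (hN.trans hNn)
  simp only [max_le_iff] at hTmax
  obtain ⟨⟨hcT, hc₀T⟩, hDT, hT1⟩ := hTmax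
  have hcT1 : c / T ≤ 1 := (div_le_one hT0).2 hcT
  have hcT0 : 0 ≤ c / T := by positivity
  set δ := (p * σ - c / T) / T with hδ
  set k := s + δ with hk
  have hδD : |δ| ≤ D / T := by
    rw [hδ, abs_div, abs_of_pos hT0]
    gcongr
    calc |p * σ - c / T| ≤ |p * σ| + |c / T| := abs_sub _ _
      _ ≤ |p| * σ + 1 := by
        rw [abs_mul, abs_of_nonneg hσ0, abs_of_nonneg hcT0]; linarith
  have hδs : |δ| ≤ s / 2 := by
    refine hδD.trans ?_
    rw [div_le_iff₀ hs0] at hDT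
    rw [div_le_iff₀ hT0]
    linarith
  obtain ⟨hδ1, hδ2⟩ := abs_le.1 hδs
  have hk1 : s / 2 ≤ k := by linarith
  have hk2 : k ≤ 2 * s := by linarith
  have hk0 : 0 < k := by linarith
  set X := T * (1 + k ^ 2) ^ (n / 2) with hX
  have hrp : 1 ≤ (1 + k ^ 2) ^ (n / 2) := one_le_rpow (by nlinarith) (by positivity)
  have hX1 : 1 ≤ X := one_le_mul_of_one_le_of_one_le hT1 hrp
  have hX0 : 0 < X := by linarith
  have hM0 : ⌊X⌋₊ ≠ 0 := (Nat.floor_pos.2 hX1).ne'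
  refine ⟨⌊X⌋₊, ?_, ?_⟩
  · obtain ⟨x, E, hx, hE, hdis, herr⟩ := exists_equal_power_code hm hM0 hP hk0
    refine ⟨x, E, hx, hE, hdis, herr.trans ?_⟩
    have hA := outside_measure_le (m := m) (by omega) hk0.le (√(n * P))
    have hB := union_bound_le (m := m) (M := ⌊X⌋₊) (by omega) hs0 hk1 hk2 (Nat.floor_le hX0.le)
    have hmT : √(m : ℝ) ≤ T := sqrt_le_sqrt (by linarith)
    have hth := threshold_le hs0 hc0.le hT0 hcT hδ hk hk0 hk2 hmT
    rw [hcdiv] at hth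
    have hsT : √(n * P) = s * T := by rw [sqrt_mul hn0.le, mul_comm]
    rw [hsT] at hA
    have hPhi : Phi ((k * √m - s * T) / √(1 + k ^ 2 / 2)) ≤ ε - K / T := by
      calc _ ≤ Phi (p - c₀ / T) := monotone_Phi hth
        _ ≤ Phi p - c₀ / T * φ := Phi_sub_le p (by positivity) ((div_le_one hT0).2 hc₀T)
        _ ≤ ε - c₀ / T * φ := by gcongr; exact Phi_PhiInv_le hε
        _ = ε - K / T := by rw [hc₀]; field_simp
    have hsm : replacementConst * k ^ 3 / √m ≤ 2 * (replacementConst * (2 * s) ^ 3) / T := by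
      have hm1 : T / 2 ≤ √(m : ℝ) := by
        apply le_sqrt_of_sq_le
        rw [div_pow, hT2]; linarith
      calc replacementConst * k ^ 3 / √m ≤ replacementConst * (2 * s) ^ 3 / (T / 2) := by gcongr
        _ = _ := by ring
    have e : K / T = 2 * (replacementConst * (2 * s) ^ 3) / T +
      288 * ((1 + 4 * s ^ 2) / s) ^ 2 * (1 + 4 * s ^ 2) / T := by rw [hK]; ring
    rw [← hsT] at hA
    rw [← hsT] at hPhi
    linarith
  · have hlogM : log (X / 2) ≤ log (⌊X⌋₊ : ℝ) :=
      log_le_log (by positivity) (half_le_natFloor hX1)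
    have hlogX : log (X / 2) = 1 / 2 * log n + n / 2 * log (1 + k ^ 2) - log 2 := by
      rw [log_div hX0.ne' two_ne_zero, hX, log_mul hT0.ne' (by positivity),
        log_rpow (by positivity), hT, log_sqrt hn0.le]
      ring
    have hnδ : n * δ ^ 2 ≤ D ^ 2 := by
      rw [le_div_iff₀ hT0] at hδD
      calc n * δ ^ 2 = (|δ| * T) ^ 2 := by rw [mul_pow, sq_abs, hT2, mul_comm]
        _ ≤ D ^ 2 := by gcongr
    have hrate := log_rate_ge hP hk hδs hn0.le hnδ
    have e1 : n * δ * s / (1 + P) = T * (s * σ / (1 + P)) * p - s * c / (1 + P) := by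
      have e4 : n * δ = T * (p * σ - c / T) := by
        rw [hδ, ← hT2, sq, mul_assoc, mul_div_cancel₀ _ hT0.ne']
      have e5 : T * (c / T) = c := mul_div_cancel₀ _ hT0.ne'
      rw [e4, mul_sub, e5]
      ring
    have e2 : √(n * gaussV P) = T * (s * σ / (1 + P)) := by
      rw [sqrt_mul_gaussV hP n hn0.le, hσ, hs2]
    have hsc : 0 ≤ s * c := (mul_pos hs0 hc0).le
    have e3 : s * c / (1 + P) ≤ s * c := div_le_self hsc (by linarith only [hP])
    rw [e1] at hrate
    rw [e2]
    linarith

end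
end
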